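/- Let q be a prime power, k = F_q(t), m a prime divisor of q−1, S = {D_1,...,D_l} nonzero polynomials in F_q[t], and γ_S the cardinality of {(a_1,...,a_l) ∈ {0,...,m−1}^l : D_1^{a_1}···D_l^{a_l} is an m-th power in F_q[t]}; write γ_S = m^r. Let M be the set of monic irreducible polynomials P with (D_1/P)_m = ··· = (D_l/P)_m = 1. Then the Dirichlet density of M equals 1/m^{l−r}; that is, lim_{s→1+} (Σ_{P ∈ M} NP^{−s}) / (Σ_P NP^{−s}) = 1/m^{l−r}, where NP = q^{deg P} and the denominator sum runs over all monic irreducible polynomials. Moreover, if K = k(D_1^{1/m},...,D_l^{1/m}) is a geometric extension of k, then the relative density of M also equals 1/m^{l−r}. -/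

import Mathlib

open Polynomial Filter

section PowerSeriesLemmas

open PowerSeries ComplexOrder

/-- If `F` has logarithmic derivative (with respect to `X d/dX`) `T` and `G` has `U`, then `F * G`
has `T + U`. -/
lemma X_mul_derivative_mul {F G T U : PowerSeries ℂ}
    (hF : PowerSeries.X * derivative ℂ F = T * F) (hG : PowerSeries.X * derivative ℂ G = U * G) :
    PowerSeries.X * derivative ℂ (F * G) = (T + U) * (F * G) := by
  rw [Derivation.leibniz, smul_eq_mul, smul_eq_mul]
  linear_combination G * hF + F * hG

lemma coeff_X_mul_derivative (F : PowerSeries ℂ) (n : ℕ) :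
    PowerSeries.coeff n (PowerSeries.X * derivative ℂ F) = n * PowerSeries.coeff n F := by
  cases n with
  | zero => simp
  | succ n => rw [PowerSeries.coeff_succ_X_mul, PowerSeries.coeff_derivative]; push_cast; ring

lemma X_mul_derivative_mk_eq_iff (S T : ℕ → ℂ) :
    PowerSeries.X * derivative ℂ (PowerSeries.mk S) = PowerSeries.mk T * PowerSeries.mk S ↔
      ∀ n : ℕ, (n : ℂ) * S n = ∑ ij ∈ Finset.HasAntidiagonal.antidiagonal n, T ij.1 * S ij.2 := by
  simp only [PowerSeries.ext_iff, coeff_X_mul_derivative]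
  simp [PowerSeries.coeff_mul]

/-- The geometric series `1 / (1 - a X)` has logarithmic derivative `∑ n ≥ 1, a ^ n X ^ n`. -/
lemma X_mul_derivative_geom (a : ℂ) :
    PowerSeries.X * derivative ℂ (PowerSeries.mk fun n ↦ a ^ n) =
      (PowerSeries.mk fun n ↦ if n = 0 then 0 else a ^ n) * PowerSeries.mk fun n ↦ a ^ n := by
  rw [X_mul_derivative_mk_eq_iff]
  intro n
  rw [Finset.Nat.sum_antidiagonal_eq_sum_range_succ_mk, Finset.sum_range_succ']
  have : ∀ k ∈ Finset.range n,
      (if k + 1 = 0 then (0 : ℂ) else a ^ (k + 1)) * a ^ (n - (k + 1)) = a ^ n := by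
    intro k hk
    rw [Finset.mem_range] at hk
    rw [if_neg (by omega), ← pow_add]
    congr 1; omega
  rw [Finset.sum_congr rfl this]
  simp

/-- A polynomial `∑ S n X ^ n` whose logarithmic derivative `∑ T n X ^ n` has coefficients of
absolute value at most `1`, infinitely often less than `1`, does not vanish at `1`. -/
lemma sum_coeff_ne_zero {S T : ℕ → ℂ} {d : ℕ} (hS0 : S 0 = 1) (hT0 : T 0 = 0)
    (hrec : ∀ n : ℕ, (n : ℂ) * S n = ∑ ij ∈ Finset.HasAntidiagonal.antidiagonal n, T ij.1 * S ij.2)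
    (hd : ∀ n, d ≤ n → S n = 0) (hT : ∀ n, ‖T n‖ ≤ 1) (hfreq : ∃ᶠ n in atTop, ‖T n‖ < 1) :
    ∑ n ∈ Finset.range d, S n ≠ 0 := by
  intro hsum
  let S' : ℕ → ℂ := fun n ↦ star (S n)
  let T' : ℕ → ℂ := fun n ↦ star (T n)
  let W : ℕ → ℂ := fun n ↦ if n = 0 then 0 else 1 ^ n
  let P : PowerSeries ℂ := PowerSeries.mk fun n ↦ (1 : ℂ) ^ n
  have hrec' : ∀ n : ℕ, (n : ℂ) * S' n = ∑ ij ∈ Finset.HasAntidiagonal.antidiagonal n,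
      T' ij.1 * S' ij.2 := by
    intro n
    have := congrArg star (hrec n)
    simpa [S', T'] using this
  have h1 := (X_mul_derivative_mk_eq_iff S T).2 hrec
  have h2 := (X_mul_derivative_mk_eq_iff S' T').2 hrec'
  have hP := X_mul_derivative_geom 1
  have hH := X_mul_derivative_mul (X_mul_derivative_mul h1 hP) (X_mul_derivative_mul h2 hP)
  set H : PowerSeries ℂ := PowerSeries.mk S * P * (PowerSeries.mk S' * P) with hHdef
  have partial_zero : ∀ R : ℕ → ℂ, (∀ n, d ≤ n → R n = 0) → ∑ n ∈ Finset.range d, R n = 0 →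
      ∀ n, d ≤ n → PowerSeries.coeff n (PowerSeries.mk R * P) = 0 := by
    intro R hR hR0 n hn
    rw [PowerSeries.coeff_mul, Finset.Nat.sum_antidiagonal_eq_sum_range_succ_mk]
    simp only [P, PowerSeries.coeff_mk, one_pow, mul_one]
    rw [← hR0]
    symm
    apply Finset.sum_subset
    · intro k; simp only [Finset.mem_range]; omega
    · intro k _ hk
      exact hR k (by simpa using hk)
  have hsum' : ∑ n ∈ Finset.range d, S' n = 0 := by
    have := congrArg star hsum
    simpa [S'] using this
  have hHzero : ∀ n, 2 * d ≤ n → PowerSeries.coeff n H = 0 := by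
    intro n hn
    rw [hHdef, PowerSeries.coeff_mul]
    apply Finset.sum_eq_zero
    intro ij hij
    rw [Finset.HasAntidiagonal.mem_antidiagonal] at hij
    rcases le_or_gt d ij.1 with h | h
    · rw [partial_zero S hd hsum _ h, zero_mul]
    · rw [partial_zero S' (fun n hn ↦ by simp [S', hd n hn]) hsum' _ (by omega), mul_zero]
  let t : ℕ → ℂ := fun n ↦ T n + W n + (T' n + W n)
  have ht : ∀ n, t n = ((if n = 0 then 0 else 2 + 2 * (T n).re : ℝ) : ℂ) := by
    intro n
    by_cases h : n = 0
    · simp [t, T', W, h, hT0]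
    · simp only [t, W, T', h, if_false, one_pow]
      have := Complex.add_conj (T n)
      rw [starRingEnd_apply] at this
      push_cast at this ⊢
      linear_combination this
  have hre : ∀ n, -‖T n‖ ≤ (T n).re := fun n ↦ (abs_le.1 (Complex.abs_re_le_norm (T n))).1
  have ht0 : ∀ n, 0 ≤ t n := by
    intro n
    rw [ht, Complex.zero_le_real]
    split_ifs with h
    · exact le_rfl
    · linarith [hre n, hT n]
  have hHrec : ∀ n : ℕ, (n : ℂ) * PowerSeries.coeff n H =
      ∑ ij ∈ Finset.HasAntidiagonal.antidiagonal n, t ij.1 * PowerSeries.coeff ij.2 H := by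
    intro n
    have := congrArg (PowerSeries.coeff n) hH
    rw [coeff_X_mul_derivative, PowerSeries.coeff_mul n _ H] at this
    rw [this]
    apply Finset.sum_congr rfl
    intro ij _
    simp [t, W]
  have hH0 : PowerSeries.coeff 0 H = 1 := by
    simp [hHdef, P, S', hS0]
  have hcoef : ∀ n, 0 ≤ PowerSeries.coeff n H := by
    intro n
    induction n using Nat.strong_induction_on with
    | _ n ih =>
      rcases Nat.eq_zero_or_pos n with rfl | hn
      · rw [hH0]; exact zero_le_one
      · have hpos : (0 : ℂ) < n := by exact_mod_cast hn
        have : 0 ≤ (n : ℂ) * PowerSeries.coeff n H := by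
          rw [hHrec]
          apply Finset.sum_nonneg
          intro ij hij
          rw [Finset.HasAntidiagonal.mem_antidiagonal] at hij
          rcases Nat.eq_zero_or_pos ij.1 with h | h
          · rw [ht, if_pos h]; simp
          · exact mul_nonneg (ht0 _) (ih _ (by omega))
        have hinv : (0 : ℂ) ≤ ((n : ℝ)⁻¹ : ℝ) := Complex.zero_le_real.2 (by positivity)
        have := mul_nonneg hinv this
        rwa [Complex.ofReal_inv, Complex.ofReal_natCast, inv_mul_cancel_left₀ hpos.ne'] at this
  obtain ⟨n, hn, hTn⟩ := frequently_atTop.1 hfreq (2 * d + 1)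
  have h0 := hHrec n
  rw [hHzero n (by omega), mul_zero] at h0
  have hz := (Finset.sum_eq_zero_iff_of_nonneg
    (fun ij _ ↦ mul_nonneg (ht0 ij.1) (hcoef ij.2))).1 h0.symm (n, 0) (by simp)
  rw [hH0, mul_one, ht, if_neg (by omega), Complex.ofReal_eq_zero] at hz
  linarith [hre n]

/-- The logarithmic derivative of a polynomial without zeros in the closed disc of radius `Q⁻¹`
has coefficients of exponential growth rate less than `Q`. -/
lemma exists_logDeriv_bound {Q : ℝ} (hQ : 0 < Q) (n : ℕ) : ∀ L : ℂ[X], L.natDegree = n →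
    L.coeff 0 = 1 → (∀ u : ℂ, ‖u‖ ≤ Q⁻¹ → L.eval u ≠ 0) →
    ∃ T : PowerSeries ℂ,
      PowerSeries.X * derivative ℂ (L : PowerSeries ℂ) = T * (L : PowerSeries ℂ) ∧
      ∃ ρ C : ℝ, 0 < ρ ∧ ρ < Q ∧ ∀ n, ‖PowerSeries.coeff n T‖ ≤ C * ρ ^ n := by
  induction n with
  | zero =>
    intro L hL h0 _
    have : L = 1 := by
      rw [Polynomial.eq_C_of_natDegree_eq_zero hL, h0, map_one]
    refine ⟨0, by simp [this], Q / 2, 0, by positivity, by linarith, by simp⟩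
  | succ n ih =>
    intro L hL h0 hroot
    obtain ⟨z, hz⟩ := Complex.exists_root (f := L)
      (Polynomial.natDegree_pos_iff_degree_pos.1 (by omega))
    obtain ⟨M, hM⟩ := Polynomial.dvd_iff_isRoot.2 hz
    have hzQ : Q⁻¹ < ‖z‖ := by
      by_contra! h
      exact hroot z h hz
    have hz0 : z ≠ 0 := by
      rintro rfl
      rw [norm_zero] at hzQ
      exact absurd hzQ (not_lt.2 (by positivity))
    set N : ℂ[X] := Polynomial.C (-z) * M with hN
    have hLN : L = (1 - Polynomial.C z⁻¹ * Polynomial.X) * N := by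
      have : Polynomial.C z⁻¹ * Polynomial.C z = 1 := by
        rw [← Polynomial.C_mul, inv_mul_cancel₀ hz0, Polynomial.C_1]
      rw [hM, hN, Polynomial.C_neg]
      linear_combination -Polynomial.X * M * this
    have hM0 : M ≠ 0 := by
      rintro rfl
      simp [hM] at hL
    have hdegN : N.natDegree = n := by
      rw [hN, Polynomial.natDegree_C_mul (neg_ne_zero.2 hz0)]
      rw [hM, Polynomial.natDegree_mul (Polynomial.X_sub_C_ne_zero z) hM0,
        Polynomial.natDegree_X_sub_C] at hL
      omega
    have hN0 : N.coeff 0 = 1 := by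
      rw [hLN, Polynomial.mul_coeff_zero] at h0
      simpa using h0
    obtain ⟨T, hT, ρ, C, hρ, hρQ, hbd⟩ := ih N hdegN hN0 (by
      intro u hu h
      apply hroot u hu
      rw [hLN, Polynomial.eval_mul, h, mul_zero])
    set a : ℂ := z⁻¹ with ha
    have haQ : ‖a‖ < Q := by
      rw [ha, norm_inv]
      exact inv_lt_of_inv_lt₀ hQ hzQ
    let U : PowerSeries ℂ := PowerSeries.mk fun n ↦ if n = 0 then 0 else a ^ n
    let A : PowerSeries ℂ := ((1 - Polynomial.C a * Polynomial.X : ℂ[X]) : PowerSeries ℂ)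
    have hA : A = 1 - PowerSeries.C a * PowerSeries.X := by simp [A]
    have hgeom : A * (PowerSeries.mk fun n ↦ a ^ n) = 1 := by
      rw [hA, sub_mul, one_mul]
      ext k
      rw [map_sub, mul_assoc, PowerSeries.coeff_C_mul]
      cases k with
      | zero => simp
      | succ k => simp [PowerSeries.coeff_succ_X_mul, PowerSeries.coeff_one, pow_succ']
    have hU : PowerSeries.X * derivative ℂ A = -U * A := by
      have h1 := X_mul_derivative_geom a
      have h2 := congrArg (derivative ℂ) hgeom
      rw [Derivation.leibniz, smul_eq_mul, smul_eq_mul, Derivation.map_one_eq_zero] at h2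
      linear_combination (PowerSeries.X * A) * h2 - A * A * h1 -
        (PowerSeries.X * derivative ℂ A + A * U) * hgeom
    refine ⟨-U + T, ?_, max ρ (max ‖a‖ (Q / 2)), |C| + 1, by positivity, ?_, ?_⟩
    · rw [hLN, Polynomial.coe_mul]
      exact X_mul_derivative_mul hU hT
    · exact max_lt hρQ (max_lt haQ (by linarith))
    · intro k
      rw [map_add, map_neg]
      refine (norm_add_le _ _).trans ?_
      rw [norm_neg, add_mul, one_mul, add_comm]
      refine add_le_add ((hbd k).trans ?_) ?_
      · exact mul_le_mul (le_abs_self C) (pow_le_pow_left₀ hρ.le (le_max_left _ _) _)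
          (by positivity) (abs_nonneg _)
      · rw [PowerSeries.coeff_mk]
        split_ifs with hk
        · rw [norm_zero]; positivity
        · rw [norm_pow]
          exact pow_le_pow_left₀ (norm_nonneg _) ((le_max_left _ _).trans (le_max_right _ _)) _

/-- If `∑ S n X ^ n` is a polynomial with logarithmic derivative `∑ T n X ^ n`, where
`‖T n‖ ≤ Q ^ n` with strict inequality infinitely often, then `T n = O(ρ ^ n)` for some `ρ < Q`. -/
lemma exists_bound_of_recursion {S T : ℕ → ℂ} {d : ℕ} {Q : ℝ} (hQ : 0 < Q)
    (hS0 : S 0 = 1) (hT0 : T 0 = 0)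
    (hrec : ∀ n : ℕ, (n : ℂ) * S n = ∑ ij ∈ Finset.HasAntidiagonal.antidiagonal n, T ij.1 * S ij.2)
    (hd : ∀ n, d ≤ n → S n = 0) (hT : ∀ n, ‖T n‖ ≤ Q ^ n)
    (hfreq : ∃ᶠ n in atTop, ‖T n‖ < Q ^ n) :
    ∃ ρ C : ℝ, 0 < ρ ∧ ρ < Q ∧ ∀ n, ‖T n‖ ≤ C * ρ ^ n := by
  let L : ℂ[X] := ∑ n ∈ Finset.range d, Polynomial.monomial n (S n)
  have hLcoeff : ∀ n, L.coeff n = S n := by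
    intro n
    simp only [L, Polynomial.finsetSum_coeff, Polynomial.coeff_monomial]
    rw [Finset.sum_ite_eq' (Finset.range d) n]
    split_ifs with h
    · rfl
    · exact (hd n (by simpa using h)).symm
  have hL : (L : PowerSeries ℂ) = PowerSeries.mk S := by
    ext n; rw [Polynomial.coeff_coe, hLcoeff, PowerSeries.coeff_mk]
  obtain ⟨T', hT', ρ, C, hρ, hρQ, hb⟩ := exists_logDeriv_bound hQ L.natDegree L rfl
    (by rw [hLcoeff, hS0]) (by
      intro u hu
      rcases eq_or_ne u 0 with rfl | hu0
      · rw [← Polynomial.coeff_zero_eq_eval_zero, hLcoeff, hS0]; exact one_ne_zero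
      have hle : ∀ n, Q ^ n * ‖u‖ ^ n ≤ 1 := by
        intro n
        rw [← mul_pow]
        apply pow_le_one₀ (by positivity)
        calc Q * ‖u‖ ≤ Q * Q⁻¹ := by gcongr
          _ = 1 := mul_inv_cancel₀ hQ.ne'
      have := sum_coeff_ne_zero (S := fun n ↦ S n * u ^ n) (T := fun n ↦ T n * u ^ n) (d := d)
        (by simp [hS0]) (by simp [hT0]) (by
          intro n
          rw [← mul_assoc, hrec, Finset.sum_mul]
          apply Finset.sum_congr rfl
          intro ij hij
          rw [← Finset.HasAntidiagonal.mem_antidiagonal.1 hij, pow_add]; ring) (by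
          intro n hn; simp [hd n hn]) (by
          intro n
          rw [norm_mul, norm_pow]
          exact (mul_le_mul_of_nonneg_right (hT n) (by positivity)).trans (hle n)) (by
          refine hfreq.mono fun n hn ↦ ?_
          rw [norm_mul, norm_pow]
          have : 0 < ‖u‖ := norm_pos_iff.2 hu0
          exact (mul_lt_mul_of_pos_right hn (by positivity)).trans_le (hle n))
      simpa [L, Polynomial.eval_finsetSum] using this)
  refine ⟨ρ, C, hρ, hρQ, fun n ↦ ?_⟩
  have h1 := (X_mul_derivative_mk_eq_iff S T).2 hrec
  rw [hL, h1] at hT'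
  have hne : PowerSeries.mk S ≠ 0 := by
    intro h
    have := congrArg (PowerSeries.coeff 0) h
    simp [hS0] at this
  have := hb n
  rwa [← mul_right_cancel₀ hne hT', PowerSeries.coeff_mk] at this

end PowerSeriesLemmas

section MonicHoms

variable {F : Type} [Field F]

/-- `ψ` is completely multiplicative on monic polynomials. -/
structure IsMonicHom (ψ : F[X] → ℂ) : Prop where
  map_one : ψ 1 = 1
  map_mul : ∀ f g : F[X], f.Monic → g.Monic → ψ (f * g) = ψ f * ψ g

lemma IsMonicHom.map_pow {ψ : F[X] → ℂ} (h : IsMonicHom ψ) {f : F[X]} (hf : f.Monic) (k : ℕ) :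
    ψ (f ^ k) = ψ f ^ k := by
  induction k with
  | zero => simp [h.map_one]
  | succ k ih => rw [pow_succ, h.map_mul _ _ (hf.pow k) hf, ih, pow_succ]

lemma isMonicHom_one : IsMonicHom (fun _ : F[X] ↦ (1 : ℂ)) := ⟨rfl, by simp⟩

end MonicHoms

section MonicPolynomials

variable (F : Type) [Field F] [Fintype F]

lemma finite_monic_natDegree_eq (n : ℕ) : {f : F[X] | f.Monic ∧ f.natDegree = n}.Finite := by
  have : Finite (degreeLT F n) := Finite.of_equiv _ (degreeLTEquiv F n).toEquiv.symm
  have h : ((degreeLT F n : Submodule F F[X]) : Set F[X]).Finite := Set.toFinite _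
  refine (h.image fun g ↦ X ^ n + g).subset ?_
  rintro f ⟨hf, rfl⟩
  refine ⟨f - X ^ f.natDegree, ?_, by simp⟩
  rw [SetLike.mem_coe, mem_degreeLT]
  rw [← degree_eq_natDegree hf.ne_zero]
  exact degree_sub_lt_left (by rw [degree_X_pow, degree_eq_natDegree hf.ne_zero]) hf.ne_zero
    (by simp [hf.leadingCoeff])

/-- The monic polynomials of degree `n` over a finite field. -/
noncomputable def monicOfDegree (n : ℕ) : Finset F[X] := (finite_monic_natDegree_eq F n).toFinset

open Classical in
/-- The monic irreducible polynomials of degree `n` over a finite field. -/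
noncomputable def primesOfDegree (n : ℕ) : Finset F[X] := (monicOfDegree F n).filter Irreducible

variable {F}

@[simp] lemma mem_monicOfDegree {n : ℕ} {f : F[X]} :
    f ∈ monicOfDegree F n ↔ f.Monic ∧ f.natDegree = n := by
  simp [monicOfDegree]

@[simp] lemma mem_primesOfDegree {n : ℕ} {f : F[X]} :
    f ∈ primesOfDegree F n ↔ (f.Monic ∧ f.natDegree = n) ∧ Irreducible f := by
  simp [primesOfDegree]

lemma card_monicOfDegree (n : ℕ) : (monicOfDegree F n).card = Fintype.card F ^ n := by
  have h : Fintype.card F ^ n = Nat.card (degreeLT F n) := by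
    rw [Nat.card_congr (degreeLTEquiv F n).toEquiv, Nat.card_eq_fintype_card, Fintype.card_fun,
      Fintype.card_fin]
  rw [h, ← Nat.card_eq_finsetCard]
  symm
  refine Nat.card_congr (Equiv.ofBijective (fun g ↦ ⟨X ^ n + g.1, ?_⟩) ⟨?_, ?_⟩)
  · have hg := mem_degreeLT.1 g.2
    rw [mem_monicOfDegree]
    refine ⟨monic_X_pow_add hg, ?_⟩
    apply natDegree_eq_of_degree_eq_some
    rw [degree_add_eq_left_of_degree_lt (by rwa [degree_X_pow]), degree_X_pow]
  · intro a b hab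
    exact Subtype.ext (add_left_cancel (congrArg Subtype.val hab))
  · rintro ⟨f, hf⟩
    obtain ⟨hfm, rfl⟩ := mem_monicOfDegree.1 hf
    refine ⟨⟨f - X ^ f.natDegree, ?_⟩, by simp⟩
    rw [mem_degreeLT, ← degree_eq_natDegree hfm.ne_zero]
    exact degree_sub_lt_left (by rw [degree_X_pow, degree_eq_natDegree hfm.ne_zero]) hfm.ne_zero
      (by simp [hfm.leadingCoeff])

open UniqueFactorizationMonoid Classical in
/-- The degree of a monic polynomial as a sum of the von Mangoldt function over its divisors. -/
lemma sum_degree_prime_pow_dvd {f : F[X]} (hf : f.Monic) :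
    f.natDegree = ∑ ij ∈ Finset.HasAntidiagonal.antidiagonal f.natDegree,
      ∑ d ∈ ij.1.divisors, ∑ P ∈ primesOfDegree F d, if P ^ (ij.1 / d) ∣ f then d else 0 := by
  have hf0 := hf.ne_zero
  have hmem : ∀ P ∈ normalizedFactors f, P.Monic ∧ Irreducible P ∧ P ∣ f := fun P hP ↦
    ⟨(monic_normalize (irreducible_of_normalized_factor P hP).ne_zero |> fun h ↦ by
        rwa [normalize_normalized_factor P hP] at h), irreducible_of_normalized_factor P hP,
      dvd_of_mem_normalizedFactors hP⟩
  have hmem' : ∀ P : F[X], P.Monic → Irreducible P → P ∣ f → P ∈ normalizedFactors f := by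
    intro P hP hirr hd
    exact (mem_normalizedFactors_iff' hf0).2 ⟨hirr, hP.normalize_eq_self, hd⟩
  have hcount : ∀ (P : F[X]) (k : ℕ), P.Monic → Irreducible P →
      (P ^ k ∣ f ↔ k ≤ (normalizedFactors f).count P) := by
    intro P k hP hirr
    rw [pow_dvd_iff_le_emultiplicity,
      emultiplicity_eq_count_normalizedFactors hirr hf0, hP.normalize_eq_self]
    exact_mod_cast Iff.rfl
  have hdeg : f.natDegree = ((normalizedFactors f).map natDegree).sum := by
    have h1 : (normalizedFactors f).prod = f := by
      rw [prod_normalizedFactors_eq hf0, hf.normalize_eq_self]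
    conv_lhs => rw [← h1]
    exact natDegree_multiset_prod_of_monic _ fun P hP ↦ (hmem P hP).1
  have hle : ∀ (P : F[X]) (k : ℕ), P.Monic → Irreducible P → P ^ k ∣ f →
      k * P.natDegree ≤ f.natDegree := by
    intro P k hP hirr hd
    have := natDegree_le_of_dvd hd hf0
    rwa [hP.natDegree_pow] at this
  have hpos : ∀ P : F[X], Irreducible P → 0 < P.natDegree := fun P hP ↦ hP.natDegree_pos
  trans ∑ P ∈ (normalizedFactors f).toFinset, (normalizedFactors f).count P • P.natDegree
  · conv_lhs => rw [hdeg, Finset.sum_multiset_map_count]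
  have hcard : ∀ P ∈ (normalizedFactors f).toFinset,
      Multiset.count P (normalizedFactors f) • P.natDegree =
        ∑ k ∈ Finset.Icc 1 f.natDegree, if P ^ k ∣ f then P.natDegree else 0 := by
    intro P hP
    rw [Multiset.mem_toFinset] at hP
    obtain ⟨h1, h2, h3⟩ := hmem P hP
    rw [← Finset.sum_filter, Finset.sum_const]
    congr 1
    trans (Finset.Icc 1 (Multiset.count P (normalizedFactors f))).card
    · simp
    congr 1
    ext k
    simp only [Finset.mem_Icc, Finset.mem_filter, hcount P k h1 h2]
    refine ⟨fun h ↦ ⟨⟨h.1, ?_⟩, h.2⟩, fun h ↦ ⟨h.1.1, h.2⟩⟩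
    have := hle P k h1 h2 ((hcount P k h1 h2).2 h.2)
    nlinarith [hpos P h2]
  rw [Finset.sum_congr rfl hcard, ← Finset.sum_product', ← Finset.sum_filter]
  simp only [Finset.sum_sigma']
  rw [← Finset.sum_filter]
  refine Finset.sum_bij'
    (fun (a : F[X] × ℕ) _ ↦ (⟨(a.2 * a.1.natDegree, f.natDegree - a.2 * a.1.natDegree),
      a.1.natDegree, a.1⟩ : (_ : ℕ × ℕ) × (_ : ℕ) × F[X]))
    (fun b _ ↦ (b.2.2, b.1.1 / b.2.1)) ?_ ?_ ?_ ?_ ?_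
  · rintro ⟨P, k⟩ h
    simp only [Finset.mem_filter, Finset.mem_product, Multiset.mem_toFinset, Finset.mem_Icc] at h
    obtain ⟨h1, h2, h3⟩ := hmem P h.1.1
    have h4 := hle P k h1 h2 h.2
    have h5 := hpos P h2
    simp only [Finset.mem_filter, Finset.mem_sigma, Finset.HasAntidiagonal.mem_antidiagonal,
      Nat.mem_divisors, mem_primesOfDegree]
    refine ⟨⟨by omega, ⟨Dvd.intro_left k rfl, ?_⟩, ⟨h1, trivial⟩, h2⟩, ?_⟩
    · exact Nat.mul_ne_zero (by omega) (by omega)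
    · rw [Nat.mul_div_cancel _ h5]; exact h.2
  · rintro ⟨⟨i, j⟩, d, P⟩ h
    simp only [Finset.mem_filter, Finset.mem_sigma, Finset.HasAntidiagonal.mem_antidiagonal,
      Nat.mem_divisors, mem_primesOfDegree] at h
    obtain ⟨⟨h1, ⟨h2, h3⟩, ⟨h4, rfl⟩, h5⟩, h6⟩ := h
    have h7 : 1 ≤ i / P.natDegree := (Nat.one_le_div_iff (hpos P h5)).2
      (Nat.le_of_dvd (by omega) h2)
    simp only [Finset.mem_filter, Finset.mem_product, Multiset.mem_toFinset, Finset.mem_Icc]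
    refine ⟨⟨hmem' P h4 h5 ((dvd_pow_self P (by omega)).trans h6), h7, ?_⟩, h6⟩
    exact (Nat.div_le_self _ _).trans (by omega)
  · rintro ⟨P, k⟩ h
    simp only [Finset.mem_filter, Finset.mem_product, Multiset.mem_toFinset, Finset.mem_Icc] at h
    simp [Nat.mul_div_cancel _ (hpos P (hmem P h.1.1).2.1)]
  · rintro ⟨⟨i, j⟩, d, P⟩ h
    simp only [Finset.mem_filter, Finset.mem_sigma, Finset.HasAntidiagonal.mem_antidiagonal,
      Nat.mem_divisors, mem_primesOfDegree] at h
    obtain ⟨⟨h1, ⟨h2, h3⟩, ⟨h4, rfl⟩, h5⟩, h6⟩ := h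
    simp only [Nat.div_mul_cancel h2]
    have : f.natDegree - i = j := by omega
    rw [this]
  · rintro ⟨P, k⟩ h
    rfl

/-- The sum of `ψ` over monic polynomials of degree `n`. -/
noncomputable def monicSum (ψ : F[X] → ℂ) (n : ℕ) : ℂ := ∑ f ∈ monicOfDegree F n, ψ f

/-- The sum of `ψ` over monic irreducible polynomials of degree `n`. -/
noncomputable def primeSum (ψ : F[X] → ℂ) (n : ℕ) : ℂ := ∑ P ∈ primesOfDegree F n, ψ P

/-- The sum of `ψ`, weighted by the von Mangoldt function, over monic polynomials of degree `n`. -/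
noncomputable def mangoldtSum (ψ : F[X] → ℂ) (n : ℕ) : ℂ :=
  ∑ d ∈ n.divisors, ∑ P ∈ primesOfDegree F d, d * ψ P ^ (n / d)

@[simp] lemma mangoldtSum_zero (ψ : F[X] → ℂ) : mangoldtSum ψ 0 = 0 := by simp [mangoldtSum]

open Classical in
lemma IsMonicHom.sum_dvd {ψ : F[X] → ℂ} (h : IsMonicHom ψ) {g : F[X]} (hg : g.Monic) (j : ℕ) :
    ∑ f ∈ monicOfDegree F (g.natDegree + j), (if g ∣ f then ψ f else 0) = ψ g * monicSum ψ j := by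
  rw [← Finset.sum_filter, monicSum, Finset.mul_sum]
  symm
  refine Finset.sum_bij (fun f _ ↦ g * f) ?_ ?_ ?_ ?_
  · intro f hf
    rw [mem_monicOfDegree] at hf
    rw [Finset.mem_filter, mem_monicOfDegree]
    refine ⟨⟨hg.mul hf.1, ?_⟩, dvd_mul_right _ _⟩
    rw [hg.natDegree_mul hf.1, hf.2]
  · intro a _ b _ hab
    exact mul_left_cancel₀ hg.ne_zero hab
  · intro f hf
    rw [Finset.mem_filter, mem_monicOfDegree] at hf
    obtain ⟨⟨h1, h2⟩, k, rfl⟩ := hf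
    have hk : k.Monic := hg.of_mul_monic_left h1
    refine ⟨k, ?_, rfl⟩
    rw [hg.natDegree_mul hk] at h2
    exact mem_monicOfDegree.2 ⟨hk, by omega⟩
  · intro f hf
    rw [mem_monicOfDegree] at hf
    rw [h.map_mul _ _ hg hf.1]

open Classical in
/-- The coefficient form of the logarithmic derivative of the Euler product of `ψ`. -/
lemma IsMonicHom.mul_monicSum {ψ : F[X] → ℂ} (h : IsMonicHom ψ) (n : ℕ) :
    (n : ℂ) * monicSum ψ n = ∑ ij ∈ Finset.HasAntidiagonal.antidiagonal n,
      mangoldtSum ψ ij.1 * monicSum ψ ij.2 := by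
  have h1 : (n : ℂ) * monicSum ψ n = ∑ f ∈ monicOfDegree F n,
      ∑ ij ∈ Finset.HasAntidiagonal.antidiagonal n,
      ∑ d ∈ ij.1.divisors, ∑ P ∈ primesOfDegree F d,
        (d : ℂ) * if P ^ (ij.1 / d) ∣ f then ψ f else 0 := by
    rw [monicSum, Finset.mul_sum]
    apply Finset.sum_congr rfl
    intro f hf
    obtain ⟨hfm, rfl⟩ := mem_monicOfDegree.1 hf
    have := congrArg (fun n : ℕ ↦ (n : ℂ) * ψ f) (sum_degree_prime_pow_dvd hfm)
    rw [this]
    push_cast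
    simp only [Finset.sum_mul]
    refine Finset.sum_congr rfl fun ij _ ↦ Finset.sum_congr rfl fun d _ ↦
      Finset.sum_congr rfl fun P _ ↦ ?_
    split_ifs <;> simp
  rw [h1, Finset.sum_comm]
  apply Finset.sum_congr rfl
  rintro ⟨i, j⟩ hij
  rw [Finset.HasAntidiagonal.mem_antidiagonal] at hij
  dsimp only at hij ⊢
  rw [Finset.sum_comm, mangoldtSum, Finset.sum_mul]
  apply Finset.sum_congr rfl
  intro d hd
  rw [Finset.sum_comm, Finset.sum_mul]
  apply Finset.sum_congr rfl
  intro P hP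
  obtain ⟨⟨hP, hPd⟩, -⟩ := mem_primesOfDegree.1 hP
  have hdeg : (P ^ (i / d)).natDegree = i := by
    rw [hP.natDegree_pow, hPd, Nat.div_mul_cancel (Nat.dvd_of_mem_divisors hd)]
  rw [← Finset.mul_sum, mul_assoc, ← h.map_pow hP, ← h.sum_dvd (hP.pow _), hdeg, hij]

/-- Gauss: the number of monic irreducible polynomials. -/
lemma sum_divisors_mul_card_primesOfDegree {n : ℕ} (hn : n ≠ 0) :
    ∑ d ∈ n.divisors, d * (primesOfDegree F d).card = Fintype.card F ^ n := by
  have hS : monicSum (fun _ : F[X] ↦ (1 : ℂ)) = fun n ↦ (Fintype.card F : ℂ) ^ n := by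
    ext n; simp [monicSum, card_monicOfDegree]
  have h1 := (X_mul_derivative_mk_eq_iff _ _).2 (isMonicHom_one (F := F)).mul_monicSum
  rw [hS, X_mul_derivative_geom] at h1
  have hne : (PowerSeries.mk fun n ↦ (Fintype.card F : ℂ) ^ n) ≠ 0 := by
    intro h
    have := congrArg (PowerSeries.coeff 0) h
    simp at this
  have h2 := congrArg (PowerSeries.coeff n) (mul_right_cancel₀ hne h1)
  rw [PowerSeries.coeff_mk, PowerSeries.coeff_mk, if_neg hn] at h2
  have h3 : ((∑ d ∈ n.divisors, d * (primesOfDegree F d).card : ℕ) : ℂ)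
      = ((Fintype.card F ^ n : ℕ) : ℂ) := by
    push_cast
    rw [h2, mangoldtSum]
    apply Finset.sum_congr rfl
    intro d _
    simp [mul_comm]
  exact_mod_cast h3

lemma mul_card_primesOfDegree_le (n : ℕ) :
    n * (primesOfDegree F n).card ≤ Fintype.card F ^ n := by
  rcases eq_or_ne n 0 with rfl | hn
  · simp
  rw [← sum_divisors_mul_card_primesOfDegree hn]
  exact Finset.single_le_sum (f := fun d ↦ d * (primesOfDegree F d).card) (fun _ _ ↦ Nat.zero_le _)
    (Nat.mem_divisors_self n hn)

lemma sum_properDivisors_mul_card_primesOfDegree_le (n : ℕ) :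
    ((∑ d ∈ n.properDivisors, d * (primesOfDegree F d).card : ℕ) : ℝ) ≤
      2 * √(Fintype.card F : ℝ) ^ n := by
  have hq : 2 ≤ Fintype.card F := Fintype.one_lt_card
  have h1 : ∑ d ∈ n.properDivisors, d * (primesOfDegree F d).card ≤
      ∑ d ∈ Finset.range (n / 2 + 1), Fintype.card F ^ d := by
    calc _ ≤ ∑ d ∈ n.properDivisors, Fintype.card F ^ d :=
          Finset.sum_le_sum fun d _ ↦ mul_card_primesOfDegree_le d
      _ ≤ _ := by
          apply Finset.sum_le_sum_of_subset
          intro d hd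
          obtain ⟨⟨k, rfl⟩, hlt⟩ := Nat.mem_properDivisors.1 hd
          have hk : 2 ≤ k := by
            by_contra! hk
            interval_cases k <;> omega
          rw [Finset.mem_range]
          have : d * 2 ≤ d * k := Nat.mul_le_mul_left d hk
          omega
  have h2 : ∑ d ∈ Finset.range (n / 2 + 1), Fintype.card F ^ d ≤ 2 * Fintype.card F ^ (n / 2) := by
    rw [Finset.sum_range_succ]
    have := Nat.geomSum_lt (m := Fintype.card F) (n := n / 2) (s := Finset.range (n / 2)) hq
      (fun k hk ↦ Finset.mem_range.1 hk)
    omega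
  have hq1 : (1 : ℝ) ≤ √(Fintype.card F : ℝ) := Real.one_le_sqrt.2 (by exact_mod_cast (by omega))
  calc ((∑ d ∈ n.properDivisors, d * (primesOfDegree F d).card : ℕ) : ℝ)
      ≤ ((2 * Fintype.card F ^ (n / 2) : ℕ) : ℝ) := by exact_mod_cast h1.trans h2
    _ = 2 * √(Fintype.card F : ℝ) ^ (2 * (n / 2)) := by
        rw [pow_mul, Real.sq_sqrt (by positivity)]; push_cast; rfl
    _ ≤ _ := by
        gcongr
        omega

lemma norm_mangoldtSum_sub_le {ψ : F[X] → ℂ}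
    (hψ : ∀ P : F[X], P.Monic → Irreducible P → ‖ψ P‖ ≤ 1) (n : ℕ) :
    ‖mangoldtSum ψ n - n * primeSum ψ n‖ ≤ 2 * √(Fintype.card F : ℝ) ^ n := by
  refine le_trans ?_ (sum_properDivisors_mul_card_primesOfDegree_le (F := F) n)
  rcases eq_or_ne n 0 with rfl | hn
  · simp
  rw [mangoldtSum, ← Nat.insert_self_properDivisors hn,
    Finset.sum_insert Nat.self_notMem_properDivisors, Nat.div_self (by omega),
    primeSum, Finset.mul_sum]
  simp only [pow_one, add_sub_cancel_left]
  push_cast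
  refine (norm_sum_le _ _).trans (Finset.sum_le_sum fun d _ ↦ (norm_sum_le _ _).trans ?_)
  rw [mul_comm, ← nsmul_eq_mul]
  apply Finset.sum_le_card_nsmul
  intro P hP
  obtain ⟨⟨hP, -⟩, hirr⟩ := mem_primesOfDegree.1 hP
  rw [norm_mul, norm_pow, Complex.norm_natCast]
  exact mul_le_of_le_one_right (by positivity) (pow_le_one₀ (norm_nonneg _) (hψ P hP hirr))

lemma norm_mangoldtSum_le {ψ : F[X] → ℂ}
    (hψ : ∀ P : F[X], P.Monic → Irreducible P → ‖ψ P‖ ≤ 1) (n : ℕ) :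
    ‖mangoldtSum ψ n‖ ≤ (Fintype.card F : ℝ) ^ n := by
  rcases eq_or_ne n 0 with rfl | hn
  · simp
  have := sum_divisors_mul_card_primesOfDegree (F := F) hn
  rw [← Nat.cast_pow, ← this, mangoldtSum]
  push_cast
  refine (norm_sum_le _ _).trans (Finset.sum_le_sum fun d _ ↦ (norm_sum_le _ _).trans ?_)
  rw [mul_comm, ← nsmul_eq_mul]
  apply Finset.sum_le_card_nsmul
  intro P hP
  obtain ⟨⟨hP, -⟩, hirr⟩ := mem_primesOfDegree.1 hP
  rw [norm_mul, norm_pow, Complex.norm_natCast]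
  exact mul_le_of_le_one_right (by positivity) (pow_le_one₀ (norm_nonneg _) (hψ P hP hirr))

lemma norm_mangoldtSum_lt {ψ : F[X] → ℂ}
    (hψ : ∀ P : F[X], P.Monic → Irreducible P → ‖ψ P‖ ≤ 1) {P₀ : F[X]} (hP₀ : P₀.Monic)
    (hirr₀ : Irreducible P₀) (h0 : ψ P₀ = 0) {n : ℕ} (hn : n ≠ 0) (hd : P₀.natDegree ∣ n) :
    ‖mangoldtSum ψ n‖ < (Fintype.card F : ℝ) ^ n := by
  have := sum_divisors_mul_card_primesOfDegree (F := F) hn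
  rw [← Nat.cast_pow, ← this, mangoldtSum]
  push_cast
  refine (norm_sum_le _ _).trans_lt ?_
  have key : ∀ d ∈ n.divisors, ∀ P ∈ primesOfDegree F d, ‖(d : ℂ) * ψ P ^ (n / d)‖ ≤ d := by
    intro d _ P hP
    obtain ⟨⟨hP, -⟩, hirr⟩ := mem_primesOfDegree.1 hP
    rw [norm_mul, norm_pow, Complex.norm_natCast]
    exact mul_le_of_le_one_right (by positivity) (pow_le_one₀ (norm_nonneg _) (hψ P hP hirr))
  refine Finset.sum_lt_sum (fun d hd ↦ (norm_sum_le _ _).trans ?_)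
    ⟨P₀.natDegree, Nat.mem_divisors.2 ⟨hd, hn⟩, (norm_sum_le _ _).trans_lt ?_⟩
  · rw [mul_comm, ← nsmul_eq_mul]
    exact Finset.sum_le_card_nsmul _ _ _ (key d hd)
  · rw [mul_comm, ← nsmul_eq_mul, ← Finset.sum_const]
    refine Finset.sum_lt_sum (key _ (Nat.mem_divisors.2 ⟨hd, hn⟩))
      ⟨P₀, mem_primesOfDegree.2 ⟨⟨hP₀, rfl⟩, hirr₀⟩, ?_⟩
    have : n / P₀.natDegree ≠ 0 := (Nat.div_pos (Nat.le_of_dvd (by omega) hd)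
      hirr₀.natDegree_pos).ne'
    rw [h0, zero_pow this, mul_zero, norm_zero]
    exact_mod_cast hirr₀.natDegree_pos

/-- The prime polynomial theorem with a power-saving error term. -/
lemma abs_mul_card_primesOfDegree_sub_le {n : ℕ} (hn : n ≠ 0) :
    |(n : ℝ) * (primesOfDegree F n).card - (Fintype.card F : ℝ) ^ n| ≤
      2 * √(Fintype.card F : ℝ) ^ n := by
  have h := sum_divisors_mul_card_primesOfDegree (F := F) hn
  rw [← Nat.insert_self_properDivisors hn,
    Finset.sum_insert Nat.self_notMem_properDivisors, add_comm] at h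
  have h' : ((∑ d ∈ n.properDivisors, d * (primesOfDegree F d).card : ℕ) : ℝ) +
      n * (primesOfDegree F n).card = (Fintype.card F : ℝ) ^ n := by exact_mod_cast h
  rw [← h', sub_add_cancel_right, abs_neg, abs_of_nonneg (by positivity)]
  exact sum_properDivisors_mul_card_primesOfDegree_le n

/-- Cancellation in prime sums of a completely multiplicative function whose `L`-function is a
polynomial. -/
lemma IsMonicHom.exists_primeSum_bound {ψ : F[X] → ℂ} (h : IsMonicHom ψ)
    (hψ : ∀ P : F[X], P.Monic → Irreducible P → ‖ψ P‖ ≤ 1) {P₀ : F[X]} (hP₀ : P₀.Monic)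
    (hirr₀ : Irreducible P₀) (h0 : ψ P₀ = 0) {d : ℕ} (hd : ∀ n, d ≤ n → monicSum ψ n = 0) :
    ∃ ρ C : ℝ, 0 < ρ ∧ ρ < Fintype.card F ∧ ∀ n : ℕ, ‖(n : ℂ) * primeSum ψ n‖ ≤ C * ρ ^ n := by
  have hq : (1 : ℝ) < Fintype.card F := by exact_mod_cast Fintype.one_lt_card (α := F)
  have hS0 : monicSum ψ 0 = 1 := by
    have : monicOfDegree F 0 = {1} := by
      ext f
      rw [mem_monicOfDegree, Finset.mem_singleton]
      exact ⟨fun h ↦ h.1.natDegree_eq_zero.1 h.2, by rintro rfl; simp⟩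
    rw [monicSum, this, Finset.sum_singleton, h.map_one]
  obtain ⟨ρ, C, hρ, hρq, hC⟩ := exists_bound_of_recursion (by linarith) hS0 (mangoldtSum_zero ψ)
    h.mul_monicSum hd (norm_mangoldtSum_le hψ) (by
      rw [frequently_atTop]
      intro a
      refine ⟨P₀.natDegree * (a + 1), ?_, norm_mangoldtSum_lt hψ hP₀ hirr₀ h0 ?_ ⟨_, rfl⟩⟩
      · nlinarith [hirr₀.natDegree_pos]
      · exact Nat.mul_ne_zero hirr₀.natDegree_pos.ne' (by omega))
  have hsq : √(Fintype.card F : ℝ) < Fintype.card F := by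
    rw [Real.sqrt_lt' (by linarith)]; nlinarith
  refine ⟨max ρ √(Fintype.card F : ℝ), |C| + 2, lt_max_of_lt_left hρ, max_lt hρq hsq, fun n ↦ ?_⟩
  have h1 := norm_mangoldtSum_sub_le hψ n
  calc ‖(n : ℂ) * primeSum ψ n‖
      = ‖mangoldtSum ψ n - (mangoldtSum ψ n - n * primeSum ψ n)‖ := by rw [sub_sub_cancel]
    _ ≤ C * ρ ^ n + 2 * √(Fintype.card F : ℝ) ^ n :=
        (norm_sub_le _ _).trans (add_le_add (hC n) h1)
    _ ≤ |C| * (max ρ √(Fintype.card F : ℝ)) ^ n + 2 * (max ρ √(Fintype.card F : ℝ)) ^ n := by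
        gcongr
        · exact le_abs_self C
        · exact le_max_left _ _
        · exact le_max_right _ _
    _ = _ := by ring

end MonicPolynomials

section Residues

variable {F : Type} [Field F] [Fintype F]

lemma norm_adjoinRoot_mk {P : F[X]} (hP : P.Monic) (hirr : Irreducible P) (a : F[X]) :
    Algebra.norm F (AdjoinRoot.mk P a) = P.resultant a := by
  classical
  have : Fact (Irreducible P) := ⟨hirr⟩
  have : Module.Finite F (AdjoinRoot P) := hP.finite_adjoinRoot
  let E := AlgebraicClosure F
  let pb := AdjoinRoot.powerBasis hP.ne_zero
  have hmin : minpoly F pb.gen = P := AdjoinRoot.minpoly_powerBasis_gen_of_monic hP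
  have hsep : (P.map (algebraMap F E)).Separable :=
    (PerfectField.separable_of_irreducible hirr).map
  apply (algebraMap F E).injective
  rw [Algebra.norm_eq_prod_embeddings F E, ← resultant_map_map]
  have hsplit : (P.map (algebraMap F E)).Splits := IsAlgClosed.splits _
  have hd : (P.map (algebraMap F E)).natDegree = P.natDegree := natDegree_map _
  have := resultant_eq_prod_eval (P.map (algebraMap F E)) (a.map (algebraMap F E)) a.natDegree
    natDegree_map_le hsplit
  rw [hd] at this
  rw [this, (hP.map _).leadingCoeff, one_pow, one_mul]
  have h2 : ∀ σ : AdjoinRoot P →ₐ[F] E, σ (AdjoinRoot.mk P a) =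
      eval (σ pb.gen) (a.map (algebraMap F E)) := by
    intro σ
    rw [eval_map_algebraMap, show pb.gen = AdjoinRoot.root P from rfl, aeval_algHom_apply,
      AdjoinRoot.aeval_eq]
  simp_rw [h2]
  rw [Fintype.prod_equiv pb.liftEquiv'
    (fun σ : AdjoinRoot P →ₐ[F] E ↦ eval (σ pb.gen) (a.map (algebraMap F E)))
    (fun x ↦ eval x.1 (a.map (algebraMap F E)))
    (fun σ ↦ by simp [PowerBasis.liftEquiv'_apply_coe])]
  have h3 : (minpoly F pb.gen).aroots E = (P.map (algebraMap F E)).roots := by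
    rw [hmin, aroots]
  have h4 : (P.map (algebraMap F E)).roots = (P.map (algebraMap F E)).roots.dedup :=
    (Multiset.dedup_eq_self.mpr (nodup_roots hsep)).symm
  rw [h4, ← Multiset.toFinset_val, ← Finset.prod_eq_multiset_prod]
  refine (Finset.prod_subtype _ (fun x ↦ ?_) fun x ↦ eval x (a.map (algebraMap F E))).symm
  rw [Multiset.mem_toFinset, h3]

/-- Euler's criterion: a power of `a` reduces modulo the prime `P` to the resultant of `P`
and `a`. -/
lemma dvd_pow_sub_C_resultant {P : F[X]} (hP : P.Monic) (hirr : Irreducible P) (a : F[X]) :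
    P ∣ a ^ ((Fintype.card F ^ P.natDegree - 1) / (Fintype.card F - 1)) - C (P.resultant a) := by
  have : Fact (Irreducible P) := ⟨hirr⟩
  have : Module.Finite F (AdjoinRoot P) := hP.finite_adjoinRoot
  have : Finite (AdjoinRoot P) := Module.finite_of_finite F
  have hcard : Nat.card (AdjoinRoot P) = Fintype.card F ^ P.natDegree := by
    rw [Module.natCard_eq_pow_finrank (K := F), (AdjoinRoot.powerBasis hP.ne_zero).finrank,
      AdjoinRoot.powerBasis_dim, Nat.card_eq_fintype_card]
  have h := FiniteField.algebraMap_norm_eq_pow (K := F) (x := AdjoinRoot.mk P a)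
  rw [norm_adjoinRoot_mk hP hirr, hcard, Nat.card_eq_fintype_card] at h
  rw [← AdjoinRoot.mk_eq_zero, map_sub, map_pow, ← h, AdjoinRoot.mk_C, sub_eq_zero]
  rfl

lemma MulChar.apply_eq_one_iff {χ : MulChar F ℂ} {m : ℕ} (hχ : orderOf χ = m)
    (hm : m ∣ Fintype.card F - 1) {x : F} (hx : x ≠ 0) :
    χ x = 1 ↔ x ^ ((Fintype.card F - 1) / m) = 1 := by
  classical
  obtain ⟨g, hg⟩ := IsCyclic.exists_generator (α := Fˣ)
  have hog : orderOf g = Fintype.card F - 1 := by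
    rw [orderOf_eq_card_of_forall_mem_zpowers hg, Nat.card_eq_fintype_card, Fintype.card_units]
  have hq1 : 0 < Fintype.card F - 1 := by have := Fintype.one_lt_card (α := F); omega
  have hm0 : 0 < m := Nat.pos_of_dvd_of_pos hm hq1
  have hgen : orderOf (χ g) = m := by
    rw [← hχ]
    refine orderOf_eq_orderOf_iff.mpr fun n ↦ ?_
    rw [MulChar.eq_iff hg, MulChar.pow_apply_coe]
    simp
  obtain ⟨k, hk⟩ := (mem_powers_iff_mem_zpowers.mpr (hg (Units.mk0 x hx)) :
    Units.mk0 x hx ∈ Submonoid.powers g)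
  have hx' : x = (g : F) ^ k := by
    rw [← Units.val_pow_eq_pow_val]; simp only at hk; rw [hk]; rfl
  rw [hx', map_pow, ← orderOf_dvd_iff_pow_eq_one, hgen, ← pow_mul, ← orderOf_dvd_iff_pow_eq_one,
    orderOf_units, hog]
  obtain ⟨c, hc⟩ := hm
  rw [hc, Nat.mul_div_cancel_left _ hm0]
  have hc0 : 0 < c := by rw [hc] at hq1; exact Nat.pos_of_mul_pos_left hq1
  exact (Nat.mul_dvd_mul_iff_right hc0).symm

lemma MulChar.norm_apply_le_one (χ : MulChar F ℂ) (x : F) : ‖χ x‖ ≤ 1 := by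
  by_cases hx : x = 0
  · simp [hx]
  · refine (Complex.norm_eq_one_of_pow_eq_one (n := Fintype.card F - 1) ?_ ?_).le
    · rw [← map_pow, FiniteField.pow_card_sub_one_eq_one x hx, map_one]
    · have := Fintype.one_lt_card (α := F); omega

end Residues

section Characters

variable {F : Type} [Field F]

lemma resultant_eq_of_dvd_sub {D f f' : F[X]} {N : ℕ} (h : D ∣ f' - f)
    (hf : f.natDegree ≤ N) (hf' : f'.natDegree ≤ N) :
    f'.resultant D N = f.resultant D N := by
  obtain ⟨p, hp⟩ := h
  have hf'' : f' = f + D * p := by rw [← hp]; ring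
  by_cases h0 : D = 0
  · rw [hf'', h0, zero_mul, add_zero]
  by_cases hp0 : p = 0
  · rw [hf'', hp0, mul_zero, add_zero]
  rw [hf'', resultant_add_mul_left _ _ _ _ _ ?_ le_rfl]
  rw [add_comm, ← natDegree_mul h0 hp0, ← hp]
  exact (natDegree_sub_le _ _).trans (max_le hf' hf)

lemma resultant_eq_pow_mul {D f : F[X]} {N : ℕ} (hf : f.natDegree ≤ N) :
    f.resultant D N = ((-1) ^ D.natDegree * D.leadingCoeff) ^ (N - f.natDegree) *
      f.resultant D := by
  obtain ⟨k, rfl⟩ := Nat.exists_eq_add_of_le hf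
  rw [resultant_add_left_deg _ _ _ _ _ le_rfl, Nat.add_sub_cancel_left, mul_pow, pow_mul]
  rfl

lemma resultant_eq_pow_of_dvd_sub_one {E g : F[X]} (h : E ∣ g - 1) :
    g.resultant E = ((-1) ^ E.natDegree * E.leadingCoeff) ^ g.natDegree := by
  rw [resultant_eq_of_dvd_sub h (by simp) le_rfl, resultant_one_left, mul_pow, ← pow_mul,
    mul_comm g.natDegree]
  rfl

lemma isMonicHom_resultant (χ : MulChar F ℂ) (D : F[X]) :
    IsMonicHom fun f ↦ χ (f.resultant D) where
  map_one := by simp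
  map_mul f g hf hg := by
    rw [hf.natDegree_mul hg, resultant_mul_left _ _ _ _ le_rfl, map_mul]

lemma apply_resultant_eq_zero (χ : MulChar F ℂ) {P D : F[X]} (hP : Irreducible P) (h : P ∣ D) :
    χ (P.resultant D) = 0 := by
  rw [resultant_eq_zero_iff.mpr ⟨Or.inl hP.ne_zero, fun hc ↦ ?_⟩, MulChar.map_zero]
  exact hP.not_isUnit (hc.isUnit_of_dvd' dvd_rfl h)

variable [Fintype F]

lemma card_sub_one_mul_div {m : ℕ} (hm : m ∣ Fintype.card F - 1) (d : ℕ) :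
    (Fintype.card F ^ d - 1) / m =
      (Fintype.card F ^ d - 1) / (Fintype.card F - 1) * ((Fintype.card F - 1) / m) := by
  have h : Fintype.card F - 1 ∣ Fintype.card F ^ d - 1 := by
    simpa using Nat.sub_dvd_pow_sub_pow (Fintype.card F) 1 d
  have hq : 0 < Fintype.card F - 1 := by have := Fintype.one_lt_card (α := F); omega
  obtain ⟨c, hc⟩ := hm
  obtain ⟨b, hb⟩ := h
  rw [hb, Nat.mul_div_cancel_left _ hq, hc]
  rw [hc] at hq
  have hm0 : 0 < m := Nat.pos_of_mul_pos_right hq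
  rw [Nat.mul_div_cancel_left _ hm0, mul_assoc, Nat.mul_div_cancel_left _ hm0, mul_comm]

/-- A residue class prime to `D = P ^ e * E`, trivial modulo `E`, on which the character of
order `m` attached to `D` does not vanish when `m ∤ e`. -/
lemma exists_apply_resultant_pow_ne_one {χ : MulChar F ℂ} {m : ℕ} (hχ : orderOf χ = m)
    (hm : m ∣ Fintype.card F - 1) {P E : F[X]} (hP : P.Monic) (hirr : Irreducible P)
    (hPE : ¬ P ∣ E) {e : ℕ} (he : ¬ m ∣ e) :
    ∃ g : F[X], E ∣ g - 1 ∧ ¬ P ∣ g ∧ χ (P.resultant g) ^ e ≠ 1 := by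
  have : Fact (Irreducible P) := ⟨hirr⟩
  have : Module.Finite F (AdjoinRoot P) := hP.finite_adjoinRoot
  have : Finite (AdjoinRoot P) := Module.finite_of_finite F
  have := Fintype.ofFinite (AdjoinRoot P)
  have hcard : Fintype.card (AdjoinRoot P) = Fintype.card F ^ P.natDegree := by
    rw [← Nat.card_eq_fintype_card, Module.natCard_eq_pow_finrank (K := F),
      (AdjoinRoot.powerBasis hP.ne_zero).finrank, AdjoinRoot.powerBasis_dim,
      Nat.card_eq_fintype_card]
  obtain ⟨u, hu⟩ := IsCyclic.exists_generator (α := (AdjoinRoot P)ˣ)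
  have hou : orderOf u = Fintype.card F ^ P.natDegree - 1 := by
    classical
    rw [orderOf_eq_card_of_forall_mem_zpowers hu, Nat.card_eq_fintype_card, Fintype.card_units,
      hcard]
  obtain ⟨h, hh⟩ := AdjoinRoot.mk_surjective (u : AdjoinRoot P)
  obtain ⟨a, b, hab⟩ := (hirr.coprime_iff_not_dvd).mpr hPE
  set g := a * P + b * E * h with hg
  have hgP : AdjoinRoot.mk P g = u := by
    rw [← hh, AdjoinRoot.mk_eq_mk]
    refine ⟨a - a * h, ?_⟩
    linear_combination h * hab
  have hPg : ¬ P ∣ g := by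
    rw [← AdjoinRoot.mk_eq_zero, hgP]
    exact u.ne_zero
  refine ⟨g, ⟨b * h - b, by linear_combination hab⟩, hPg, fun hone ↦ he ?_⟩
  have hx : P.resultant g ≠ 0 := resultant_ne_zero _ _ ((hirr.coprime_iff_not_dvd).mpr hPg)
  rw [← map_pow, MulChar.apply_eq_one_iff hχ hm (pow_ne_zero _ hx)] at hone
  have h1 := dvd_pow_sub_C_resultant hP hirr g
  rw [← AdjoinRoot.mk_eq_zero, map_sub, sub_eq_zero, map_pow, hgP] at h1
  have h2 : (u : AdjoinRoot P) ^ ((Fintype.card F ^ P.natDegree - 1) / m * e) = 1 := by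
    rw [card_sub_one_mul_div hm, mul_assoc, pow_mul, h1, ← map_pow, ← C_pow, mul_comm, pow_mul,
      hone, C_1, map_one]
  rw [← orderOf_dvd_iff_pow_eq_one, orderOf_units, hou] at h2
  have hmd : m ∣ Fintype.card F ^ P.natDegree - 1 :=
    hm.trans (by simpa using Nat.sub_dvd_pow_sub_pow (Fintype.card F) 1 P.natDegree)
  have hpos : 0 < Fintype.card F ^ P.natDegree - 1 := by
    have := Nat.one_lt_pow hirr.natDegree_pos.ne' (Fintype.one_lt_card (α := F))
    omega
  obtain ⟨c, hc⟩ := hmd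
  rw [hc] at h2 hpos
  have hm0 : 0 < m := Nat.pos_of_mul_pos_right hpos
  rw [Nat.mul_div_cancel_left _ hm0, mul_comm] at h2
  exact Nat.dvd_of_mul_dvd_mul_left (Nat.pos_of_mul_pos_left hpos) h2

lemma monicSum_apply_resultant_eq_zero {χ : MulChar F ℂ} {m : ℕ} (hχ : orderOf χ = m)
    (hm : m ∣ Fintype.card F - 1) {P E : F[X]} (hP : P.Monic) (hirr : Irreducible P)
    (hPE : ¬ P ∣ E) {e : ℕ} (he : ¬ m ∣ e) {n : ℕ} (hn : (P ^ e * E).natDegree ≤ n) :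
    monicSum (fun f ↦ χ (f.resultant (P ^ e * E))) n = 0 := by
  classical
  obtain ⟨g, hgE, hPg, hne⟩ := exists_apply_resultant_pow_ne_one hχ hm hP hirr hPE he
  have hE : E ≠ 0 := by rintro rfl; simp at hPE
  have hg0 : g ≠ 0 := by rintro rfl; simp at hPg
  set D := P ^ e * E with hDdef
  have hD : D ≠ 0 := mul_ne_zero (pow_ne_zero _ hP.ne_zero) hE
  have hcop : IsCoprime D g := by
    refine IsCoprime.mul_left (IsCoprime.pow_left ((hirr.coprime_iff_not_dvd).mpr hPg)) ?_
    obtain ⟨c, hc⟩ := hgE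
    exact ⟨-c, 1, by linear_combination hc⟩
  set φ : F[X] → F[X] := fun f ↦ f + ((g * f) % D - f % D) with hφ
  have hφdvd : ∀ f, D ∣ φ f - g * f := fun f ↦ by
    refine ⟨f / D - g * f / D, ?_⟩
    have h1 := EuclideanDomain.div_add_mod f D
    have h2 := EuclideanDomain.div_add_mod (g * f) D
    simp only [hφ]
    linear_combination h2 - h1
  have hdeg : ∀ f, f ∈ monicOfDegree F n → ((g * f) % D - f % D).degree < f.degree := by
    intro f hf
    rw [mem_monicOfDegree] at hf
    refine ((degree_sub_le _ _).trans_lt (max_lt (degree_mod_lt _ hD)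
      (degree_mod_lt _ hD))).trans_le ?_
    rw [degree_eq_natDegree hD, degree_eq_natDegree hf.1.ne_zero, hf.2]
    exact_mod_cast hn
  have hφmem : ∀ f ∈ monicOfDegree F n, φ f ∈ monicOfDegree F n := fun f hf ↦ by
    have h1 := hdeg f hf
    rw [mem_monicOfDegree] at hf ⊢
    exact ⟨hf.1.add_of_left h1, by rw [hφ, natDegree_add_eq_left_of_degree_lt h1, hf.2]⟩
  have hφinj : Set.InjOn φ (monicOfDegree F n) := fun f₁ _ f₂ _ h ↦ by
    have h1 : D ∣ g * (f₁ - f₂) := by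
      have := dvd_sub (hφdvd f₂) (hφdvd f₁)
      rw [h] at this
      convert this using 1
      ring
    have h2 : D ∣ f₁ - f₂ := hcop.dvd_of_dvd_mul_left h1
    have h3 : f₁ % D = f₂ % D := mod_eq_of_dvd_sub h2
    have h4 : (g * f₁) % D = (g * f₂) % D := mod_eq_of_dvd_sub (by rwa [← mul_sub])
    simp only [hφ, h3, h4] at h
    exact add_right_cancel h
  have himage : (monicOfDegree F n).image φ = monicOfDegree F n :=
    Finset.eq_of_subset_of_card_le (Finset.image_subset_iff.mpr hφmem)
      (Finset.card_image_of_injOn hφinj).ge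
  have hres : ∀ f ∈ monicOfDegree F n,
      (φ f).resultant D = P.resultant g ^ e * f.resultant D := fun f hf ↦ by
    have hf' := hφmem f hf
    rw [mem_monicOfDegree] at hf hf'
    have hdgf : (g * f).natDegree = g.natDegree + n := by
      rw [natDegree_mul hg0 hf.1.ne_zero, hf.2]
    have h1 := resultant_eq_of_dvd_sub (N := g.natDegree + n) (hφdvd f) hdgf.le
      (hf'.2.le.trans (by lia))
    have h2 : (g * f).resultant D (g.natDegree + n) = g.resultant D * f.resultant D := by
      rw [← resultant_mul_left _ _ _ _ le_rfl, hf.2]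
    rw [resultant_eq_pow_mul (by lia), hf'.2, Nat.add_sub_cancel, h2] at h1
    have hu : ((-1) ^ D.natDegree * D.leadingCoeff) ^ g.natDegree ≠ 0 := by simp [hD]
    apply mul_left_cancel₀ hu
    rw [hf'.2, hf.2, h1, hf.2, ← mul_assoc]
    congr 1
    have hPe : (P ^ e).natDegree = e * P.natDegree := natDegree_pow _ _
    have h3 : g.resultant D = g.resultant P ^ e * g.resultant E := by
      rw [hDdef, natDegree_mul (pow_ne_zero _ hP.ne_zero) hE, resultant_mul_right _ _ _ _ le_rfl,
        resultant_pow_right _ _ _ _ le_rfl (by simp [hP])]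
    rw [h3, resultant_eq_pow_of_dvd_sub_one hgE, resultant_comm, hDdef, leadingCoeff_mul,
      natDegree_mul (pow_ne_zero _ hP.ne_zero) hE, leadingCoeff_pow, hP.leadingCoeff, hPe]
    ring
  have hsum : monicSum (fun f ↦ χ (f.resultant D)) n =
      χ (P.resultant g) ^ e * monicSum (fun f ↦ χ (f.resultant D)) n := by
    conv_lhs => rw [monicSum, ← himage, Finset.sum_image hφinj]
    rw [monicSum, Finset.mul_sum]
    exact Finset.sum_congr rfl fun f hf ↦ by rw [hres f hf, map_mul, map_pow]
  have : (1 - χ (P.resultant g) ^ e) * monicSum (fun f ↦ χ (f.resultant D)) n = 0 := by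
    rw [sub_mul, ← hsum, one_mul, sub_self]
  exact (mul_eq_zero.mp this).resolve_left (sub_ne_zero.mpr hne.symm)

lemma apply_resultant_eq_one_iff {χ : MulChar F ℂ} {m : ℕ} (hχ : orderOf χ = m)
    (hm : m ∣ Fintype.card F - 1) {P a : F[X]} (hP : P.Monic) (hirr : Irreducible P)
    (hPa : ¬ P ∣ a) {c : F}
    (hc : P ∣ a ^ ((Fintype.card F ^ P.natDegree - 1) / m) - C c) :
    c = 1 ↔ χ (P.resultant a) = 1 := by
  have hx : P.resultant a ≠ 0 := resultant_ne_zero _ _ ((hirr.coprime_iff_not_dvd).mpr hPa)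
  rw [MulChar.apply_eq_one_iff hχ hm hx]
  suffices c = P.resultant a ^ ((Fintype.card F - 1) / m) by rw [this]
  have h1 := (dvd_pow_sub_C_resultant hP hirr a).trans
    (sub_dvd_pow_sub_pow _ _ ((Fintype.card F - 1) / m))
  rw [← pow_mul, ← card_sub_one_mul_div hm, ← C_pow] at h1
  have h2 := dvd_sub h1 hc
  rw [sub_sub_sub_cancel_left, ← C_sub] at h2
  by_contra hne
  exact hirr.not_isUnit (isUnit_of_dvd_unit h2 (isUnit_C.mpr (sub_ne_zero.mpr hne).isUnit))

end Characters

section TupleAsymptotics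

variable {F : Type} [Field F]

/-- A nonzero polynomial either has a prime factor whose multiplicity is not divisible by `m`,
or it is a constant times an `m`-th power. -/
lemma exists_prime_pow_mul_or_eq_C_mul_pow (m : ℕ) {D : F[X]} (hD : D ≠ 0) :
    (∃ (P E : F[X]) (e : ℕ), P.Monic ∧ Irreducible P ∧ ¬ P ∣ E ∧ ¬ m ∣ e ∧ D = P ^ e * E) ∨
      ∃ (c : F) (G : F[X]), D = C c * G ^ m := by
  classical
  induction hn : D.natDegree using Nat.strong_induction_on generalizing D with
  | _ n ih =>
    by_cases hu : IsUnit D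
    · obtain ⟨c, -, rfl⟩ := isUnit_iff.mp hu
      exact Or.inr ⟨c, 1, by simp⟩
    obtain ⟨P, hirr, hP, hPD⟩ : ∃ P : F[X], Irreducible P ∧ P.Monic ∧ P ∣ D := by
      obtain ⟨P, hirr, hPD⟩ := WfDvdMonoid.exists_irreducible_factor hu hD
      exact ⟨normalize P, (normalize_associated P).symm.irreducible hirr,
        monic_normalize hirr.ne_zero, (normalize_associated P).dvd.trans hPD⟩
    obtain ⟨e, E, hPE, rfl⟩ := WfDvdMonoid.max_power_factor' hD hirr.not_isUnit
    by_cases hme : m ∣ e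
    · have hE : E ≠ 0 := right_ne_zero_of_mul hD
      have he0 : e ≠ 0 := by
        rintro rfl
        rw [pow_zero, one_mul] at hPD
        exact hPE hPD
      have hlt : E.natDegree < n := by
        rw [← hn, natDegree_mul (pow_ne_zero _ hP.ne_zero) hE, natDegree_pow]
        have := Nat.mul_pos (Nat.pos_of_ne_zero he0) hirr.natDegree_pos
        omega
      rcases ih _ hlt hE rfl with ⟨P', E', e', hP', hirr', hPE', hme', rfl⟩ | ⟨c, G, rfl⟩
      · refine Or.inl ⟨P', P ^ e * E', e', hP', hirr', fun hdvd ↦ ?_, hme', by ring⟩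
        rcases hirr'.prime.dvd_or_dvd hdvd with h | h
        · have hPP : P' = P := eq_of_monic_of_associated hP' hP
            (hirr'.associated_of_dvd hirr (hirr'.prime.dvd_of_dvd_pow h))
          have he' : e' ≠ 0 := by
            rintro rfl
            exact hme' (dvd_zero m)
          exact hPE (by rw [← hPP]; exact (dvd_pow_self P' he').mul_right E')
        · exact hPE' h
      · obtain ⟨k, rfl⟩ := hme
        exact Or.inr ⟨c, P ^ k * G, by ring⟩
    · exact Or.inl ⟨P, E, e, hP, hirr, hPE, hme, rfl⟩

lemma not_exists_eq_pow_of_prime_pow_mul {m : ℕ} {P E : F[X]} {e : ℕ} (hirr : Irreducible P)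
    (hPE : ¬ P ∣ E) (hme : ¬ m ∣ e) : ¬ ∃ G : F[X], P ^ e * E = G ^ m := by
  rintro ⟨G, hG⟩
  have hE : E ≠ 0 := by rintro rfl; simp at hPE
  have hm : m ≠ 0 := by
    rintro rfl
    rw [pow_zero] at hG
    have he : e ≠ 0 := by rintro rfl; simp at hme
    exact hirr.not_isUnit (isUnit_of_dvd_one ((dvd_pow_self P he).trans (Dvd.intro _ hG)))
  have hG0 : G ≠ 0 := by
    rintro rfl
    rw [zero_pow hm] at hG
    exact mul_ne_zero (pow_ne_zero e hirr.ne_zero) hE hG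
  have h := congrArg (emultiplicity P) hG
  rw [emultiplicity_mul hirr.prime, emultiplicity_pow_self_of_prime hirr.prime,
    emultiplicity_eq_zero.mpr hPE, emultiplicity_pow hirr.prime, add_zero,
    (FiniteMultiplicity.of_not_isUnit hirr.not_isUnit hG0).emultiplicity_eq_multiplicity] at h
  exact hme ⟨multiplicity P G, by exact_mod_cast h⟩

variable [Fintype F]

lemma MulChar.apply_eq_one_iff_exists_pow {χ : MulChar F ℂ} {m : ℕ} (hχ : orderOf χ = m)
    (hm : m ∣ Fintype.card F - 1) {c : F} (hc : c ≠ 0) :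
    χ c = 1 ↔ ∃ d : F, c = d ^ m := by
  classical
  have hq1 : 0 < Fintype.card F - 1 := by have := Fintype.one_lt_card (α := F); omega
  have hm0 : 0 < m := Nat.pos_of_dvd_of_pos hm hq1
  refine ⟨fun h ↦ ?_, ?_⟩
  · rw [MulChar.apply_eq_one_iff hχ hm hc] at h
    obtain ⟨g, hg⟩ := IsCyclic.exists_generator (α := Fˣ)
    have hog : orderOf g = Fintype.card F - 1 := by
      rw [orderOf_eq_card_of_forall_mem_zpowers hg, Nat.card_eq_fintype_card, Fintype.card_units]
    obtain ⟨k, hk⟩ := (mem_powers_iff_mem_zpowers.mpr (hg (Units.mk0 c hc)) :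
      Units.mk0 c hc ∈ Submonoid.powers g)
    have hc' : c = (g : F) ^ k := by
      rw [← Units.val_pow_eq_pow_val]; simp only at hk; rw [hk]; rfl
    rw [hc', ← pow_mul, ← orderOf_dvd_iff_pow_eq_one, orderOf_units, hog] at h
    obtain ⟨b, hb⟩ := hm
    rw [hb, Nat.mul_div_cancel_left _ hm0] at h
    rw [hb] at hq1
    obtain ⟨j, rfl⟩ := Nat.dvd_of_mul_dvd_mul_right (Nat.pos_of_mul_pos_left hq1) h
    exact ⟨(g : F) ^ j, by rw [hc', ← pow_mul, mul_comm]⟩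
  · rintro ⟨d, rfl⟩
    have hd : d ≠ 0 := by
      rintro rfl
      exact hc (zero_pow hm0.ne')
    rw [map_pow, ← MulChar.pow_apply' χ hm0.ne', ← hχ, pow_orderOf_eq_one,
      MulChar.one_apply hd.isUnit]

lemma summable_mul_card_primesOfDegree_sub :
    Summable fun n : ℕ ↦ (n : ℝ) * (primesOfDegree F n).card / (Fintype.card F : ℝ) ^ n - 1 := by
  have hq : (1 : ℝ) < Fintype.card F := by exact_mod_cast Fintype.one_lt_card
  set q : ℝ := (Fintype.card F : ℝ)
  have hq0 : (0 : ℝ) < q := by linarith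
  have hgeom : Summable fun n : ℕ ↦ 2 * (√q / q) ^ n := by
    refine (summable_geometric_of_lt_one (by positivity) ?_).mul_left 2
    rw [Real.sqrt_div_self', div_lt_one (by positivity)]
    exact Real.lt_sqrt_of_sq_lt (by simpa using hq)
  refine Summable.of_norm_bounded_eventually_nat hgeom ?_
  filter_upwards [eventually_ne_atTop 0] with n hn
  have h := abs_mul_card_primesOfDegree_sub_le (F := F) hn
  rw [Real.norm_eq_abs, div_sub_one (by positivity), abs_div, abs_of_pos (pow_pos hq0 n),
    div_le_iff₀ (by positivity), mul_assoc, ← mul_pow, div_mul_cancel₀ _ hq0.ne']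
  exact h

lemma exists_summable_mul_primeSum_sub {χ : MulChar F ℂ} {m : ℕ} (hχ : orderOf χ = m)
    (hm : m ∣ Fintype.card F - 1) {D : F[X]} (hD : D ≠ 0) :
    ∃ ζ : ℂ, ‖ζ‖ ≤ 1 ∧ (ζ = 1 ↔ ∃ G : F[X], D = G ^ m) ∧
      (ζ = 0 ∨ ∃ (c : F) (G : F[X]), D = C c * G ^ m) ∧
      Summable fun n : ℕ ↦ (n : ℂ) * primeSum (fun f ↦ χ (f.resultant D)) n /
        (Fintype.card F : ℂ) ^ n - ζ ^ n := by
  have hq : (1 : ℝ) < Fintype.card F := by exact_mod_cast Fintype.one_lt_card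
  have hq1 : 0 < Fintype.card F - 1 := by have := Fintype.one_lt_card (α := F); omega
  have hm0 : 0 < m := Nat.pos_of_dvd_of_pos hm hq1
  rcases exists_prime_pow_mul_or_eq_C_mul_pow m hD with
    ⟨P, E, e, hP, hirr, hPE, hme, rfl⟩ | ⟨c, G, rfl⟩
  · refine ⟨0, by simp, ?_, Or.inl rfl, ?_⟩
    · simpa using not_exists_eq_pow_of_prime_pow_mul hirr hPE hme
    · have he : e ≠ 0 := by rintro rfl; simp at hme
      obtain ⟨ρ, B, hρ, hρq, hB⟩ := (isMonicHom_resultant χ (P ^ e * E)).exists_primeSum_bound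
        (fun _ _ _ ↦ χ.norm_apply_le_one _) hP hirr
        (apply_resultant_eq_zero χ hirr ((dvd_pow_self P he).mul_right E))
        (fun n hn ↦ monicSum_apply_resultant_eq_zero hχ hm hP hirr hPE hme hn)
      have hgeom : Summable fun n : ℕ ↦ B * (ρ / Fintype.card F) ^ n :=
        (summable_geometric_of_lt_one (by positivity)
          ((div_lt_one (by positivity)).mpr hρq)).mul_left B
      refine Summable.of_norm_bounded_eventually_nat hgeom ?_
      filter_upwards [eventually_ne_atTop 0] with n hn
      rw [zero_pow hn, sub_zero, norm_div, norm_pow, Complex.norm_natCast,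
        div_le_iff₀ (by positivity), mul_assoc, ← mul_pow,
        div_mul_cancel₀ _ (by positivity)]
      exact hB n
  · have hc : c ≠ 0 := by rintro rfl; simp at hD
    have hG : G ≠ 0 := by
      rintro rfl
      simp [hm0.ne'] at hD
    refine ⟨χ c, χ.norm_apply_le_one c, ?_, Or.inr ⟨c, G, rfl⟩, ?_⟩
    · rw [MulChar.apply_eq_one_iff_exists_pow hχ hm hc]
      constructor
      · rintro ⟨d, rfl⟩
        exact ⟨C d * G, by rw [mul_pow, C_pow]⟩
      · rintro ⟨H, hH⟩
        refine ⟨H.leadingCoeff / G.leadingCoeff, ?_⟩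
        have := congrArg leadingCoeff hH
        rw [leadingCoeff_mul, leadingCoeff_C, leadingCoeff_pow, leadingCoeff_pow] at this
        rw [div_pow, ← this, mul_div_cancel_right₀ _ (pow_ne_zero _ (by simpa using hG))]
    · have hval : ∀ n, G.natDegree < n →
          primeSum (fun f ↦ χ (f.resultant (C c * G ^ m))) n =
            χ c ^ n * (primesOfDegree F n).card := by
        intro n hn
        rw [primeSum, mul_comm (χ c ^ n), ← nsmul_eq_mul, ← Finset.sum_const]
        refine Finset.sum_congr rfl fun P hP ↦ ?_
        obtain ⟨⟨hmon, hdeg⟩, hirr⟩ := mem_primesOfDegree.mp hP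
        have hPG : ¬ P ∣ G := fun h ↦ by
          have := natDegree_le_of_dvd h hG
          omega
        have hne : P.resultant G ≠ 0 :=
          resultant_ne_zero _ _ ((hirr.coprime_iff_not_dvd).mpr hPG)
        rw [natDegree_C_mul hc, resultant_C_mul_right, resultant_pow_right _ _ _ _ le_rfl
          (by simpa using fun h ↦ absurd h hG), map_mul,
          (MulChar.apply_eq_one_iff_exists_pow hχ hm (pow_ne_zero m hne)).mpr ⟨_, rfl⟩, mul_one,
          map_pow, hdeg]
      have hsum : Summable fun n : ℕ ↦ χ c ^ n * (((n : ℝ) * (primesOfDegree F n).card /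
          (Fintype.card F : ℝ) ^ n - 1 : ℝ) : ℂ) := by
        refine Summable.of_norm_bounded (summable_mul_card_primesOfDegree_sub (F := F)).norm
          fun n ↦ ?_
        rw [norm_mul, Complex.norm_real, norm_pow]
        exact mul_le_of_le_one_left (norm_nonneg _) (pow_le_one₀ (norm_nonneg _)
          (χ.norm_apply_le_one c))
      refine (summable_congr_atTop ?_).mpr hsum
      filter_upwards [eventually_gt_atTop G.natDegree] with n hn
      rw [hval n hn]
      push_cast
      ring

end TupleAsymptotics

section AbelianLimit

lemma tendsto_neg_log_one_sub :
    Tendsto (fun y : ℝ ↦ -Real.log (1 - y)) (nhdsWithin 1 (Set.Iio 1)) atTop := by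
  refine tendsto_neg_atBot_atTop.comp (Real.tendsto_log_nhdsGT_zero.comp ?_)
  refine tendsto_nhdsWithin_iff.mpr ⟨?_, ?_⟩
  · have : Tendsto (fun y : ℝ ↦ 1 - y) (nhds 1) (nhds (1 - 1)) :=
      tendsto_const_nhds.sub tendsto_id
    rw [sub_self] at this
    exact this.mono_left nhdsWithin_le_nhds
  · filter_upwards [self_mem_nhdsWithin] with y hy
    simpa using hy

lemma tendsto_neg_log_one_sub_mul_div {ζ : ℂ} (hζ : ‖ζ‖ ≤ 1) :
    Tendsto (fun y : ℝ ↦ -Complex.log (1 - ζ * y) / (-Real.log (1 - y) : ℝ))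
      (nhdsWithin 1 (Set.Iio 1)) (nhds (if ζ = 1 then 1 else 0)) := by
  split_ifs with h
  · refine tendsto_const_nhds.congr' ?_
    filter_upwards [self_mem_nhdsWithin, tendsto_neg_log_one_sub.eventually_gt_atTop 0]
      with y hy hpos
    rw [h, one_mul, ← Complex.ofReal_one, ← Complex.ofReal_sub,
      ← Complex.ofReal_log (sub_nonneg.mpr (le_of_lt hy)), ← Complex.ofReal_neg,
      div_self (Complex.ofReal_ne_zero.mpr hpos.ne'), Complex.ofReal_one]
  · have hre : ζ.re < 1 := by
      refine lt_of_le_of_ne ((Complex.re_le_norm ζ).trans hζ) fun hre ↦ h ?_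
      have h1 : ζ.re ^ 2 + ζ.im ^ 2 ≤ 1 := by
        have := Complex.normSq_eq_norm_sq ζ
        rw [Complex.normSq_apply] at this
        nlinarith [norm_nonneg ζ]
      have him : ζ.im = 0 := by
        rw [hre] at h1
        nlinarith
      exact Complex.ext hre him
    have hslit : 1 - ζ * ((1 : ℝ) : ℂ) ∈ Complex.slitPlane := by
      refine Or.inl ?_
      simpa using hre
    have hlog : Tendsto (fun y : ℝ ↦ -Complex.log (1 - ζ * y)) (nhdsWithin 1 (Set.Iio 1))
        (nhds (-Complex.log (1 - ζ * ((1 : ℝ) : ℂ)))) := by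
      refine Tendsto.mono_left (ContinuousAt.tendsto ?_) nhdsWithin_le_nhds
      exact ((by fun_prop : ContinuousAt (fun y : ℝ ↦ 1 - ζ * (y : ℂ)) 1).clog hslit).neg
    have hinv : Tendsto (fun y : ℝ ↦ (((-Real.log (1 - y))⁻¹ : ℝ) : ℂ))
        (nhdsWithin 1 (Set.Iio 1)) (nhds ((0 : ℝ) : ℂ)) :=
      (Complex.continuous_ofReal.tendsto 0).comp
        (tendsto_inv_atTop_zero.comp tendsto_neg_log_one_sub)
    have := hlog.mul hinv
    rw [Complex.ofReal_zero, mul_zero] at this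
    refine this.congr fun y ↦ ?_
    rw [Complex.ofReal_inv, div_eq_mul_inv]

/-- If `b n` is a sum of `n`-th powers of points of the closed unit disc up to a summable error,
then `∑ b n * y ^ n / n` divided by `-log (1 - y)` tends to the number of those points equal
to `1` as `y → 1⁻`. -/
lemma tendsto_tsum_mul_pow_div {ι : Type*} [Fintype ι] {b : ℕ → ℂ} {ζ : ι → ℂ}
    (hζ : ∀ i, ‖ζ i‖ ≤ 1) (hb : Summable fun n ↦ b n - ∑ i, ζ i ^ n) :
    Tendsto (fun y : ℝ ↦ (∑' n : ℕ, b n * (y ^ n / n)) / (-Real.log (1 - y) : ℝ))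
      (nhdsWithin 1 (Set.Iio 1)) (nhds (Finset.univ.filter (ζ · = 1)).card) := by
  have hunit : ∀ {y : ℝ}, 0 < y → y < 1 → ∀ n : ℕ, ‖((y : ℂ) ^ n / n)‖ ≤ 1 := by
    intro y h0 h1 n
    rw [norm_div, norm_pow, Complex.norm_natCast, Complex.norm_of_nonneg h0.le]
    rcases Nat.eq_zero_or_pos n with rfl | hn
    · simp
    · exact div_le_one_of_le₀ ((pow_le_one₀ h0.le h1.le).trans (by exact_mod_cast hn))
        (by positivity)
  have hsmall : ∀ {y : ℝ}, 0 < y → y < 1 → ∀ n : ℕ,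
      ‖(b n - ∑ i, ζ i ^ n) * ((y : ℂ) ^ n / n)‖ ≤ ‖b n - ∑ i, ζ i ^ n‖ := fun h0 h1 n ↦ by
    rw [norm_mul]
    exact mul_le_of_le_one_right (norm_nonneg _) (hunit h0 h1 n)
  have hdecomp : ∀ y : ℝ, 0 < y → y < 1 → (∑' n : ℕ, b n * ((y : ℂ) ^ n / n)) =
      (∑' n : ℕ, (b n - ∑ i, ζ i ^ n) * ((y : ℂ) ^ n / n)) +
        ∑ i, -Complex.log (1 - ζ i * y) := by
    intro y h0 h1
    have hs1 : Summable fun n : ℕ ↦ (b n - ∑ i, ζ i ^ n) * ((y : ℂ) ^ n / n) :=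
      Summable.of_norm_bounded hb.norm (hsmall h0 h1)
    have hs2 : HasSum (fun n : ℕ ↦ ∑ i, (ζ i * y) ^ n / n)
        (∑ i, -Complex.log (1 - ζ i * y)) := by
      refine hasSum_sum fun i _ ↦ Complex.hasSum_taylorSeries_neg_log ?_
      rw [norm_mul, Complex.norm_of_nonneg h0.le]
      exact (mul_le_of_le_one_left h0.le (hζ i)).trans_lt h1
    refine ((hs1.hasSum.add hs2).congr_fun ?_).tsum_eq
    intro n
    rw [sub_mul, Finset.sum_mul]
    simp [mul_pow, mul_div_assoc]
  have herr : Tendsto (fun y : ℝ ↦ (∑' n : ℕ, (b n - ∑ i, ζ i ^ n) * ((y : ℂ) ^ n / n)) /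
      (-Real.log (1 - y) : ℝ)) (nhdsWithin 1 (Set.Iio 1)) (nhds 0) := by
    have hlim : Tendsto (fun y : ℝ ↦ (∑' n : ℕ, ‖b n - ∑ i, ζ i ^ n‖) / (-Real.log (1 - y)))
        (nhdsWithin 1 (Set.Iio 1)) (nhds 0) := tendsto_neg_log_one_sub.const_div_atTop _
    refine squeeze_zero_norm' ?_ hlim
    filter_upwards [self_mem_nhdsWithin, tendsto_neg_log_one_sub.eventually_gt_atTop 0,
      nhdsWithin_le_nhds (Ioi_mem_nhds (zero_lt_one' ℝ))] with y hy hpos h0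
    rw [norm_div, Complex.norm_of_nonneg hpos.le]
    gcongr
    exact tsum_of_norm_bounded hb.norm.hasSum (hsmall h0 hy)
  have hmain : Tendsto (fun y : ℝ ↦ ∑ i, -Complex.log (1 - ζ i * y) / (-Real.log (1 - y) : ℝ))
      (nhdsWithin 1 (Set.Iio 1)) (nhds (∑ i, if ζ i = 1 then 1 else 0)) :=
    tendsto_finsetSum _ fun i _ ↦ tendsto_neg_log_one_sub_mul_div (hζ i)
  have := herr.add hmain
  rw [zero_add, Finset.sum_boole] at this
  refine this.congr' ?_
  filter_upwards [self_mem_nhdsWithin, nhdsWithin_le_nhds (Ioi_mem_nhds (zero_lt_one' ℝ))]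
    with y hy h0
  rw [hdecomp y h0 hy, add_div, Finset.sum_div]

end AbelianLimit

section PrimeSeries

variable {F : Type} [Field F] [Fintype F]

open Classical in
lemma natCard_monic_irreducible_natDegree {r : F[X] → Prop}
    (hr : ∀ P, r P → P.Monic ∧ Irreducible P) (n : ℕ) :
    Nat.card {P : F[X] // r P ∧ P.natDegree = n} = ((primesOfDegree F n).filter r).card := by
  refine Nat.subtype_card _ fun P ↦ ?_
  rw [Finset.mem_filter, mem_primesOfDegree]
  exact ⟨fun h ↦ ⟨h.2, h.1.1.2⟩, fun h ↦ ⟨⟨⟨(hr P h.1).1, h.2⟩, (hr P h.1).2⟩, h.1⟩⟩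

lemma rpow_pow_neg {q : ℝ} (hq : 0 < q) (n : ℕ) (s : ℝ) :
    (q ^ n) ^ (-s) = (q ^ (1 - s)) ^ n / q ^ n := by
  rw [← Real.rpow_natCast, ← Real.rpow_natCast, ← Real.rpow_mul hq.le, ← Real.rpow_mul hq.le,
    ← Real.rpow_sub hq]
  ring_nf

open Classical in
lemma tsum_rpow_natDegree {r : F[X] → Prop} (hr : ∀ P, r P → P.Monic ∧ Irreducible P) {s : ℝ}
    (hs : 1 < s) :
    ∑' P : {P : F[X] // r P}, ((Fintype.card F : ℝ) ^ (P : F[X]).natDegree) ^ (-s) =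
      ∑' n : ℕ, (n : ℝ) * ((primesOfDegree F n).filter r).card / (Fintype.card F : ℝ) ^ n *
        (((Fintype.card F : ℝ) ^ (1 - s)) ^ n / n) := by
  have hq : (1 : ℝ) < Fintype.card F := by exact_mod_cast Fintype.one_lt_card
  set q : ℝ := (Fintype.card F : ℝ)
  have hq0 : 0 < q := by linarith
  set y : ℝ := q ^ (1 - s)
  have hy0 : 0 < y := by positivity
  have hy1 : y < 1 := Real.rpow_lt_one_of_one_lt_of_neg hq (by linarith)
  let e := Equiv.sigmaFiberEquiv fun P : {P : F[X] // r P} ↦ (P : F[X]).natDegree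
  have hfiber : ∀ n : ℕ, Nat.card {P : {P : F[X] // r P} // (P : F[X]).natDegree = n} =
      ((primesOfDegree F n).filter r).card := fun n ↦ by
    rw [← natCard_monic_irreducible_natDegree hr]
    exact Nat.card_congr (Equiv.subtypeSubtypeEquivSubtypeInter r fun P ↦ P.natDegree = n)
  have hfin : ∀ n : ℕ, Finite {P : {P : F[X] // r P} // (P : F[X]).natDegree = n} := fun n ↦ by
    refine Finite.of_injective (β := primesOfDegree F n) (fun P ↦ ⟨P.1.1, ?_⟩) ?_
    · exact mem_primesOfDegree.mpr ⟨⟨(hr _ P.1.2).1, P.2⟩, (hr _ P.1.2).2⟩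
    · intro P Q h
      exact Subtype.ext (Subtype.ext (by simpa using h))
  have hval : ∀ n, ∀ P : {P : {P : F[X] // r P} // (P : F[X]).natDegree = n},
      (q ^ ((e ⟨n, P⟩ : {P : F[X] // r P}) : F[X]).natDegree) ^ (-s) = y ^ n / q ^ n :=
    fun n P ↦ by
      rw [rpow_pow_neg hq0, show ((e ⟨n, P⟩ : {P : F[X] // r P}) : F[X]).natDegree = n from P.2]
  have hle : ∀ n, (((primesOfDegree F n).filter r).card : ℝ) * (y ^ n / q ^ n) ≤ y ^ n :=
      fun n ↦ by
    have h1 : (((primesOfDegree F n).filter r).card : ℝ) ≤ q ^ n := by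
      have h2 : (primesOfDegree F n).card ≤ (monicOfDegree F n).card :=
        Finset.card_le_card (Finset.filter_subset _ _)
      have h3 := (Finset.card_filter_le (primesOfDegree F n) r).trans h2
      rw [card_monicOfDegree, ← Nat.cast_le (α := ℝ), Nat.cast_pow] at h3
      exact h3
    rw [← mul_div_assoc, div_le_iff₀ (by positivity), mul_comm]
    exact mul_le_mul_of_nonneg_left h1 (by positivity)
  have htsum : ∀ n, ∑' P : {P : {P : F[X] // r P} // (P : F[X]).natDegree = n},
      (q ^ ((e ⟨n, P⟩ : {P : F[X] // r P}) : F[X]).natDegree) ^ (-s) =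
        ((primesOfDegree F n).filter r).card * (y ^ n / q ^ n) := fun n ↦ by
    simp_rw [hval n]
    rw [tsum_const, hfiber, nsmul_eq_mul]
  have hsum : Summable fun x : Σ n, {P : {P : F[X] // r P} // (P : F[X]).natDegree = n} ↦
      (q ^ ((e x : {P : F[X] // r P}) : F[X]).natDegree) ^ (-s) := by
    refine (summable_sigma_of_nonneg fun _ ↦ by positivity).mpr
      ⟨fun n ↦ Summable.of_finite, ?_⟩
    simp_rw [htsum]
    exact Summable.of_nonneg_of_le (fun n ↦ by positivity) hle
      (summable_geometric_of_lt_one hy0.le hy1)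
  rw [← e.tsum_eq, hsum.tsum_sigma]
  refine tsum_congr fun n ↦ ?_
  rw [htsum]
  rcases Nat.eq_zero_or_pos n with rfl | hn
  · have : (primesOfDegree F 0).filter r = ∅ := by
      refine Finset.filter_eq_empty_iff.mpr fun P hP ↦ ?_
      obtain ⟨⟨-, h0⟩, hirr⟩ := mem_primesOfDegree.mp hP
      exact absurd h0 hirr.natDegree_pos.ne'
    simp [this]
  · field_simp

open Classical in
/-- If the number of primes of degree `n` satisfying `r`, weighted by `κ * n / q ^ n`, is a sum
of `n`-th powers of points of the unit disc up to a summable error, then the Dirichlet series of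
`r` is asymptotic to `-log (1 - q ^ (1 - s))` times the number of those points equal to `1`. -/
lemma tendsto_tsum_rpow_natDegree_div {r : F[X] → Prop}
    (hr : ∀ P, r P → P.Monic ∧ Irreducible P) {ι : Type*} [Fintype ι] {ζ : ι → ℂ} {κ : ℝ}
    (hζ : ∀ i, ‖ζ i‖ ≤ 1)
    (hb : Summable fun n : ℕ ↦ ((κ * (n * ((primesOfDegree F n).filter r).card /
      (Fintype.card F : ℝ) ^ n) : ℝ) : ℂ) - ∑ i, ζ i ^ n) :
    Tendsto (fun s : ℝ ↦ κ * (∑' P : {P : F[X] // r P},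
        ((Fintype.card F : ℝ) ^ (P : F[X]).natDegree) ^ (-s)) /
        (-Real.log (1 - (Fintype.card F : ℝ) ^ (1 - s))))
      (nhdsWithin 1 (Set.Ioi 1)) (nhds (Nat.card {i // ζ i = 1})) := by
  have hq : (1 : ℝ) < Fintype.card F := by exact_mod_cast Fintype.one_lt_card
  have hq0 : (0 : ℝ) < Fintype.card F := by linarith
  have hy : Tendsto (fun s : ℝ ↦ (Fintype.card F : ℝ) ^ (1 - s)) (nhdsWithin 1 (Set.Ioi 1))
      (nhdsWithin 1 (Set.Iio 1)) := by
    refine tendsto_nhdsWithin_iff.mpr ⟨?_, ?_⟩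
    · have h1 : ContinuousAt (fun s : ℝ ↦ (Fintype.card F : ℝ) ^ (1 - s)) 1 :=
        ContinuousAt.rpow (by fun_prop) (by fun_prop) (Or.inl hq0.ne')
      have h2 := h1.tendsto
      rw [sub_self, Real.rpow_zero] at h2
      exact h2.mono_left nhdsWithin_le_nhds
    · filter_upwards [self_mem_nhdsWithin] with s hs
      exact Real.rpow_lt_one_of_one_lt_of_neg hq (sub_neg.mpr hs)
  have hmain := (tendsto_tsum_mul_pow_div hζ hb).comp hy
  rw [Nat.card_eq_fintype_card, Fintype.card_subtype, ← tendsto_ofReal_iff,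
    Complex.ofReal_natCast]
  refine Tendsto.congr' ?_ (by convert hmain)
  filter_upwards [self_mem_nhdsWithin] with s hs
  rw [tsum_rpow_natDegree hr hs, ← tsum_mul_left]
  simp only [Function.comp]
  push_cast
  congr 1
  refine tsum_congr fun n ↦ ?_
  ring

lemma sum_prod_pow_fin {l m : ℕ} {x : Fin l → ℂ} (hx : ∀ i, x i ^ m = 1)
    [Decidable (∀ i, x i = 1)] :
    ∑ a : Fin l → Fin m, ∏ i, x i ^ (a i : ℕ) = if ∀ i, x i = 1 then (m : ℂ) ^ l else 0 := by
  have h : ∑ a : Fin l → Fin m, ∏ i, x i ^ (a i : ℕ) = ∏ i, ∑ j : Fin m, x i ^ (j : ℕ) := by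
    rw [Finset.prod_univ_sum, Fintype.piFinset_univ]
  rw [h]
  split_ifs with h1
  · simp [h1]
  · obtain ⟨i, hi⟩ := not_forall.mp h1
    refine Finset.prod_eq_zero (Finset.mem_univ i) ?_
    rw [Fin.sum_univ_eq_sum_range (fun j ↦ x i ^ j) m, geom_sum_eq hi, hx, sub_self, zero_div]

end PrimeSeries

section Orthogonality

variable {F : Type} [Field F] [Fintype F]

open Classical in
lemma sum_primeSum_eq {χ : MulChar F ℂ} {m : ℕ} (hχ : orderOf χ = m)
    (hm : m ∣ Fintype.card F - 1) {l : ℕ} {D : Fin l → F[X]} (hD : ∀ i, D i ≠ 0)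
    {sym : F[X] → F[X] → F}
    (hsym : ∀ P a : F[X], P.Monic → Irreducible P → ¬ P ∣ a →
      P ∣ (a ^ ((Fintype.card F ^ P.natDegree - 1) / m) - C (sym P a)))
    {n : ℕ} (hn : ∀ i, (D i).natDegree < n) :
    ∑ a : Fin l → Fin m, primeSum (fun f ↦ χ (f.resultant (∏ i, D i ^ (a i : ℕ)))) n =
      (m : ℂ) ^ l * ((primesOfDegree F n).filter fun P ↦
        P.Monic ∧ Irreducible P ∧ ∀ i, sym P (D i) = 1).card := by
  simp only [primeSum]
  rw [Finset.sum_comm, Finset.card_filter, Nat.cast_sum, Finset.mul_sum]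
  refine Finset.sum_congr rfl fun P hP ↦ ?_
  obtain ⟨⟨hmon, hdeg⟩, hirr⟩ := mem_primesOfDegree.mp hP
  have hPD : ∀ i, ¬ P ∣ D i := fun i h ↦ by
    have h1 := natDegree_le_of_dvd h (hD i)
    have h2 := hn i
    omega
  have hne : ∀ i, P.resultant (D i) ≠ 0 := fun i ↦
    resultant_ne_zero _ _ ((hirr.coprime_iff_not_dvd).mpr (hPD i))
  have hprod : ∀ a : Fin l → Fin m, χ (P.resultant (∏ i, D i ^ (a i : ℕ))) =
      ∏ i, χ (P.resultant (D i)) ^ (a i : ℕ) := fun a ↦ by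
    rw [resultant_prod_right _ _ _ _ le_rfl
      (Finset.prod_ne_zero_iff.mpr fun i _ ↦ by simp [hD i]), map_prod]
    refine Finset.prod_congr rfl fun i _ ↦ ?_
    rw [resultant_pow_right _ _ _ _ le_rfl (by simp [hD i]), map_pow]
  simp_rw [hprod]
  rw [sum_prod_pow_fin fun i ↦ by
    rw [← map_pow]
    exact (MulChar.apply_eq_one_iff_exists_pow hχ hm (pow_ne_zero m (hne i))).mpr ⟨_, rfl⟩]
  simp only [← apply_resultant_eq_one_iff hχ hm hmon hirr (hPD _)
    (hsym P _ hmon hirr (hPD _)), hmon, hirr, true_and]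
  split_ifs <;> simp

open Classical in
lemma exists_summable_mul_card_sub {m : ℕ} (hm : m ∣ Fintype.card F - 1) {l : ℕ}
    {D : Fin l → F[X]} (hD : ∀ i, D i ≠ 0) {sym : F[X] → F[X] → F}
    (hsym : ∀ P a : F[X], P.Monic → Irreducible P → ¬ P ∣ a →
      P ∣ (a ^ ((Fintype.card F ^ P.natDegree - 1) / m) - C (sym P a))) :
    ∃ ζ : (Fin l → Fin m) → ℂ, (∀ a, ‖ζ a‖ ≤ 1) ∧
      (∀ a, ζ a = 1 ↔ ∃ G : F[X], (∏ i, D i ^ (a i : ℕ)) = G ^ m) ∧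
      (∀ a, ζ a = 0 ∨ ∃ (c : F) (G : F[X]), (∏ i, D i ^ (a i : ℕ)) = C c * G ^ m) ∧
      Summable fun n : ℕ ↦ (((m : ℝ) ^ l * (n * ((primesOfDegree F n).filter fun P ↦
        P.Monic ∧ Irreducible P ∧ ∀ i, sym P (D i) = 1).card / (Fintype.card F : ℝ) ^ n) : ℝ) :
          ℂ) - ∑ a, ζ a ^ n := by
  have hq1 : 0 < Fintype.card F - 1 := by have := Fintype.one_lt_card (α := F); omega
  have hm0 : m ≠ 0 := (Nat.pos_of_dvd_of_pos hm hq1).ne'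
  obtain ⟨χ, hχ⟩ := MulChar.exists_mulChar_orderOf F hm (Complex.isPrimitiveRoot_exp m hm0)
  choose ζ hζ1 hζpow hζ0 hsum using fun a : Fin l → Fin m ↦
    exists_summable_mul_primeSum_sub hχ hm (D := ∏ i, D i ^ (a i : ℕ))
      (Finset.prod_ne_zero_iff.mpr fun i _ ↦ pow_ne_zero _ (hD i))
  refine ⟨ζ, hζ1, hζpow, hζ0, ?_⟩
  refine (summable_congr_atTop ?_).mpr (summable_sum fun a (_ : a ∈ Finset.univ) ↦ hsum a)
  filter_upwards [eventually_gt_atTop (Finset.univ.sup fun i ↦ (D i).natDegree)] with n hn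
  rw [Finset.sum_sub_distrib, ← Finset.sum_div, ← Finset.mul_sum,
    sum_primeSum_eq hχ hm hD hsym fun i ↦
      (Finset.le_sup (f := fun i ↦ (D i).natDegree) (Finset.mem_univ i)).trans_lt hn]
  push_cast
  ring

lemma tendsto_ratio {α : Type*} {𝓕 : Filter α} {u v w : α → ℝ} {κ c : ℝ} (hκ : κ ≠ 0)
    (hu : Tendsto (fun x ↦ κ * u x / w x) 𝓕 (nhds c)) (hv : Tendsto (fun x ↦ v x / w x) 𝓕 (nhds 1))
    (hw : ∀ᶠ x in 𝓕, w x ≠ 0) : Tendsto (fun x ↦ u x / v x) 𝓕 (nhds (c / κ)) := by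
  have h := (hu.div hv one_ne_zero).div_const κ
  rw [div_one] at h
  refine h.congr' ?_
  filter_upwards [hw] with x hx
  simp only [Pi.div_apply]
  rw [div_div_div_cancel_right₀ hx, div_right_comm, mul_div_cancel_left₀ _ hκ]

end Orthogonality

section Density

variable {F : Type} [Field F] [Fintype F]

lemma filter_monic_irreducible_primesOfDegree
    {_ : DecidablePred fun P : F[X] ↦ P.Monic ∧ Irreducible P} (n : ℕ) :
    (primesOfDegree F n).filter (fun P ↦ P.Monic ∧ Irreducible P) = primesOfDegree F n :=
  Finset.filter_true_of_mem fun P hP ↦ by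
    rw [mem_primesOfDegree] at hP
    exact ⟨hP.1.1, hP.2⟩

/-- Under the hypotheses of `tendsto_tsum_rpow_natDegree_div`, the set of primes satisfying `r` has
Dirichlet density `κ⁻¹` times the number of indices `i` with `ζ i = 1`. -/
lemma tendsto_tsum_div_tsum {r : F[X] → Prop} [DecidablePred r]
    (hr : ∀ P, r P → P.Monic ∧ Irreducible P) {ι : Type*} [Fintype ι] {ζ : ι → ℂ} {κ : ℝ}
    (hκ : κ ≠ 0) (hζ : ∀ i, ‖ζ i‖ ≤ 1)
    (hb : Summable fun n : ℕ ↦ ((κ * (n * ((primesOfDegree F n).filter r).card /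
      (Fintype.card F : ℝ) ^ n) : ℝ) : ℂ) - ∑ i, ζ i ^ n) :
    Tendsto (fun s : ℝ ↦
        (∑' P : {P : F[X] // r P}, ((Fintype.card F : ℝ) ^ (P : F[X]).natDegree) ^ (-s)) /
        (∑' P : {P : F[X] // P.Monic ∧ Irreducible P},
          ((Fintype.card F : ℝ) ^ (P : F[X]).natDegree) ^ (-s)))
      (nhdsWithin 1 (Set.Ioi 1)) (nhds (Nat.card {i // ζ i = 1} / κ)) := by
  have hnum := tendsto_tsum_rpow_natDegree_div hr hζ (κ := κ) (by convert hb)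
  have hden := tendsto_tsum_rpow_natDegree_div (F := F)
    (r := fun P ↦ P.Monic ∧ Irreducible P) (fun P h ↦ h) (ι := Unit) (ζ := fun _ ↦ 1) (κ := 1)
    (by simp) (by
      refine (Complex.ofRealCLM.summable (summable_mul_card_primesOfDegree_sub (F := F))).congr
        fun n ↦ ?_
      rw [filter_monic_irreducible_primesOfDegree]
      simp [mul_div_assoc])
  simp only [one_mul] at hden
  refine tendsto_ratio hκ hnum (by simpa using hden) ?_
  filter_upwards [self_mem_nhdsWithin] with s hs
  have hq : (1 : ℝ) < Fintype.card F := by exact_mod_cast Fintype.one_lt_card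
  have h0 : 0 < (Fintype.card F : ℝ) ^ (1 - s) := Real.rpow_pos_of_pos (by linarith) _
  have h1 : (Fintype.card F : ℝ) ^ (1 - s) < 1 :=
    Real.rpow_lt_one_of_one_lt_of_neg hq (sub_neg.mpr hs)
  exact neg_ne_zero.mpr (Real.log_neg (by linarith) (by linarith)).ne

lemma tendsto_natCard_div_natCard {r : F[X] → Prop} [DecidablePred r]
    (hr : ∀ P, r P → P.Monic ∧ Irreducible P) {ι : Type*} [Fintype ι] {ζ : ι → ℂ} {κ : ℝ}
    (hκ : κ ≠ 0) (hζ : ∀ i, ζ i = 0 ∨ ζ i = 1)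
    (hb : Summable fun n : ℕ ↦ ((κ * (n * ((primesOfDegree F n).filter r).card /
      (Fintype.card F : ℝ) ^ n) : ℝ) : ℂ) - ∑ i, ζ i ^ n) :
    Tendsto (fun n : ℕ ↦ (Nat.card {P : F[X] // r P ∧ P.natDegree = n} : ℝ) /
        (Nat.card {P : F[X] // (P.Monic ∧ Irreducible P) ∧ P.natDegree = n} : ℝ))
      atTop (nhds (Nat.card {i // ζ i = 1} / κ)) := by
  classical
  have hq0 : (Fintype.card F : ℝ) ≠ 0 := by exact_mod_cast Fintype.card_ne_zero
  have hsum : ∀ n : ℕ, n ≠ 0 → ∑ i, ζ i ^ n = (Nat.card {i // ζ i = 1} : ℝ) := fun n hn ↦ by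
    rw [Nat.card_eq_fintype_card, Fintype.card_subtype, Finset.card_filter]
    push_cast
    refine Finset.sum_congr rfl fun i _ ↦ ?_
    rcases hζ i with h | h <;> simp [h, hn]
  have hnum : Tendsto (fun n : ℕ ↦ κ * ((primesOfDegree F n).filter r).card /
      ((Fintype.card F : ℝ) ^ n / n)) atTop (nhds (Nat.card {i // ζ i = 1})) := by
    have h := hb.tendsto_atTop_zero.add_const ((Nat.card {i // ζ i = 1} : ℝ) : ℂ)
    rw [zero_add] at h
    rw [← Filter.tendsto_ofReal_iff]
    refine h.congr' ?_
    filter_upwards [eventually_ne_atTop 0] with n hn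
    rw [hsum n hn, sub_add_cancel]
    congr 1
    field_simp
  have hden : Tendsto (fun n : ℕ ↦ ((primesOfDegree F n).card : ℝ) /
      ((Fintype.card F : ℝ) ^ n / n)) atTop (nhds 1) := by
    have h := (summable_mul_card_primesOfDegree_sub (F := F)).tendsto_atTop_zero.add_const 1
    rw [zero_add] at h
    refine h.congr fun n ↦ ?_
    rw [sub_add_cancel, div_div_eq_mul_div, mul_comm]
  refine (tendsto_ratio hκ hnum hden ?_).congr fun n ↦ ?_
  · filter_upwards [eventually_ne_atTop 0] with n hn
    positivity
  · rw [natCard_monic_irreducible_natDegree hr, natCard_monic_irreducible_natDegree fun P h ↦ h,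
      filter_monic_irreducible_primesOfDegree]
    congr!

end Density

section Geometric

/-- If every element of `K` algebraic over `F` comes from `F`, then a constant multiple of an `m`-th
power of polynomials that becomes an `m`-th power in `K` is the `m`-th power of a polynomial. -/
lemma exists_eq_pow_of_algebraMap_eq_pow {F : Type*} [Field F] {K : Type*} [Field K]
    [Algebra (RatFunc F) K] [Algebra F K] [IsScalarTower F (RatFunc F) K]
    (hgeom : ∀ x : K, IsAlgebraic F x → ∃ c : F, algebraMap F K c = x) {m : ℕ} (hm : m ≠ 0)
    {f G : F[X]} (hf : f ≠ 0) {c : F} (hfG : f = C c * G ^ m) {z : K}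
    (hz : z ^ m = algebraMap (RatFunc F) K (algebraMap F[X] (RatFunc F) f)) :
    ∃ H : F[X], f = H ^ m := by
  have hG : G ≠ 0 := by
    rintro rfl
    simp [hm] at hfG
    exact hf hfG
  have hinj : Function.Injective
      ((algebraMap (RatFunc F) K).comp (algebraMap F[X] (RatFunc F))) :=
    (algebraMap (RatFunc F) K).injective.comp (IsFractionRing.injective F[X] (RatFunc F))
  have hC : ∀ c : F, algebraMap (RatFunc F) K (algebraMap F[X] (RatFunc F) (C c)) =
      algebraMap F K c := fun c ↦ by
    rw [IsScalarTower.algebraMap_apply F (RatFunc F) K, RatFunc.algebraMap_C,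
      RatFunc.algebraMap_eq_C]
  set g := algebraMap (RatFunc F) K (algebraMap F[X] (RatFunc F) G) with hg
  have hg0 : g ≠ 0 := (map_ne_zero_iff _ hinj).mpr hG
  have hpow : (z / g) ^ m = algebraMap F K c := by
    rw [div_pow, hz, hfG, map_mul, map_mul, hC, map_pow, map_pow, ← hg,
      mul_div_cancel_right₀ _ (pow_ne_zero m hg0)]
  obtain ⟨c', hc'⟩ := hgeom (z / g) (IsAlgebraic.of_pow (Nat.pos_of_ne_zero hm)
    (hpow ▸ isAlgebraic_algebraMap c))
  refine ⟨C c' * G, ?_⟩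
  rw [← hc', ← map_pow] at hpow
  rw [hfG, mul_pow, ← C_pow, (algebraMap F K).injective hpow]

end Geometric

/-- **Dirichlet (and relative) density of simultaneous `m`-th power residues
(Theorem 4.2).**
Let `q` be a prime power, `k = F_q(t)`, `m` a prime divisor of `q−1`,
`S = {D_1,...,D_l}` nonzero polynomials in `F_q[t]`, and `γ_S = m^r` the cardinality of
`{(a_1,...,a_l) ∈ {0,...,m−1}^l : D_1^{a_1}···D_l^{a_l}` is an `m`-th power in `F_q[t]}`.
Let `M` be the set of monic irreducible `P` with `(D_1/P)_m = ⋯ = (D_l/P)_m = 1`.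
Then the Dirichlet density of `M` equals `1/m^{l−r}`, i.e.
`lim_{s→1⁺} (Σ_{P∈M} NP^{−s})/(Σ_P NP^{−s}) = 1/m^{l−r}` where `NP = q^{deg P}`.
Moreover, if `K = k(D_1^{1/m},...,D_l^{1/m})` is a geometric extension of `k`, then the
relative density of `M` also equals `1/m^{l−r}`. -/
theorem kummer_dirichlet_density
    (p e : ℕ) (hp : p.Prime) (he : 0 < e)
    (Fq : Type) [Field Fq] [Fintype Fq] (hq : Fintype.card Fq = p ^ e)
    (m : ℕ) (hm : m.Prime) (hmq : m ∣ Fintype.card Fq - 1)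
    (l : ℕ) (D : Fin l → Polynomial Fq) (hD : ∀ i, D i ≠ 0)
    -- the m-th power residue symbol `(a/P)_m ∈ F_q`
    (sym : Polynomial Fq → Polynomial Fq → Fq)
    (hsym0 : ∀ P a : Polynomial Fq, P ∣ a → sym P a = 0)
    (hsym1 : ∀ P a : Polynomial Fq, P.Monic → Irreducible P → ¬ P ∣ a →
      P ∣ (a ^ ((Fintype.card Fq ^ P.natDegree - 1) / m) - C (sym P a)))
    -- `γ_S = m^r`
    (r : ℕ) (hrl : r ≤ l)
    (hr : Nat.card {a : Fin l → Fin m //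
      ∃ F : Polynomial Fq, (∏ i, D i ^ (a i : ℕ)) = F ^ m} = m ^ r)
    -- `K = k(D_1^{1/m},...,D_l^{1/m})`
    (K : Type) [Field K] [Algebra (RatFunc Fq) K] [Algebra Fq K]
    [IsScalarTower Fq (RatFunc Fq) K]
    (y : Fin l → K)
    (hy : ∀ i, y i ^ m =
      algebraMap (RatFunc Fq) K (algebraMap (Polynomial Fq) (RatFunc Fq) (D i)))
    (hgen : Algebra.adjoin (RatFunc Fq) (Set.range y) = ⊤) :
    -- the Dirichlet density of `M` is `1/m^{l−r}` ...
    Tendsto (fun s : ℝ =>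
        (∑' P : {P : Polynomial Fq //
            P.Monic ∧ Irreducible P ∧ ∀ i, sym P (D i) = 1},
            ((Fintype.card Fq : ℝ) ^ (P : Polynomial Fq).natDegree) ^ (-s)) /
          (∑' P : {P : Polynomial Fq // P.Monic ∧ Irreducible P},
            ((Fintype.card Fq : ℝ) ^ (P : Polynomial Fq).natDegree) ^ (-s)))
      (nhdsWithin 1 (Set.Ioi (1 : ℝ))) (nhds (1 / (m : ℝ) ^ (l - r))) ∧
    -- ... and if `K/k` is geometric, the relative density of `M` is also `1/m^{l−r}`
    ((∀ x : K, IsAlgebraic Fq x → ∃ c : Fq, algebraMap Fq K c = x) →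
      Tendsto (fun N : ℕ =>
          (Nat.card {P : Polynomial Fq //
              P.Monic ∧ Irreducible P ∧ P.natDegree = N ∧ ∀ i, sym P (D i) = 1} : ℝ) /
            (Nat.card {P : Polynomial Fq //
              P.Monic ∧ Irreducible P ∧ P.natDegree = N} : ℝ))
        atTop (nhds (1 / (m : ℝ) ^ (l - r)))) := by
  classical
  have hm0 : (m : ℝ) ≠ 0 := by exact_mod_cast hm.ne_zero
  have hlim : (1 : ℝ) / (m : ℝ) ^ (l - r) = (m : ℝ) ^ r / (m : ℝ) ^ l := by
    rw [div_eq_div_iff (pow_ne_zero _ hm0) (pow_ne_zero _ hm0), one_mul, ← pow_add,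
      Nat.add_sub_cancel' hrl]
  obtain ⟨ζ, hζ1, hζpow, hζ0, hsum⟩ := exists_summable_mul_card_sub hmq hD hsym1
  have hcard : (Nat.card {a // ζ a = 1} : ℝ) = (m : ℝ) ^ r := by
    rw [Nat.card_congr (Equiv.subtypeEquivRight hζpow), hr, Nat.cast_pow]
  rw [hlim, ← hcard]
  have hprime : ∀ P : Fq[X], (P.Monic ∧ Irreducible P ∧ ∀ i, sym P (D i) = 1) →
      P.Monic ∧ Irreducible P := fun P h ↦ ⟨h.1, h.2.1⟩
  refine ⟨tendsto_tsum_div_tsum hprime (pow_ne_zero l hm0) hζ1 (by convert hsum),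
    fun hgeom ↦ ?_⟩
  have hζ : ∀ a, ζ a = 0 ∨ ζ a = 1 := fun a ↦ by
    refine (hζ0 a).imp_right fun ⟨c, G, h⟩ ↦ (hζpow a).mpr ?_
    refine exists_eq_pow_of_algebraMap_eq_pow hgeom hm.ne_zero
      (Finset.prod_ne_zero_iff.mpr fun i _ ↦ pow_ne_zero _ (hD i)) h
      (z := ∏ i, y i ^ (a i : ℕ)) ?_
    simp only [map_prod, map_pow, ← hy, ← Finset.prod_pow, ← pow_mul, mul_comm]
  refine (tendsto_natCard_div_natCard hprime (pow_ne_zero l hm0) hζ (by convert hsum)).congr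
    fun n ↦ ?_
  congr 2
  · exact Nat.card_congr (Equiv.subtypeEquivRight fun P ↦ by tauto)
  · exact Nat.card_congr (Equiv.subtypeEquivRight fun P ↦ by tauto)
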